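/- arXiv:1904.12506 — 3 statements merged into one kernel-verified Lean document; each statement's English description precedes it below -/
import Mathlib

section
/- Let m > n > 1 be integers and let ν be a Borel probability measure on [0,1]² (identified with 𝕋²) which is invariant under T_m × T_n and satisfies: (1) P₂ν = ρ, where ρ is a continuous (non-atomic) T_n-invariant ergodic measure, and P₁ν = λ; (2) there exists δ > 0 such that for every Borel probability measure τ on [0,1] with dim τ ≥ 1 − δ, for ρ-almost every y one has dim(τ * P₁ν_y) = 1, where ν_y is the conditional measure of ν on the fiber {(x,z) : z = y}. Then ν = λ × ρ. -/
open MeasureTheory Filter Set Topology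
open scoped ENNReal

/-- The (lower) Hausdorff dimension of a measure:
`dim μ = inf { dim_H A : A Borel, μ(A) > 0 }`. -/
noncomputable def measureDim {X : Type*} [EMetricSpace X] [MeasurableSpace X]
    (μ : Measure X) : ℝ≥0∞ :=
  ⨅ (A : Set X) (_ : MeasurableSet A) (_ : 0 < μ A), dimH A

/-- The disintegration `{ν_y}` of a measure `ν` on a product space with respect to the
projection to the second coordinate: `ν_y` is the conditional measure on the fiber
`{(x, z) : z = y}`, viewed as a measure on the first coordinate. -/
noncomputable def fiberMeasure {X Y : Type*} [MeasurableSpace X] [MeasurableSpace Y]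
    [StandardBorelSpace X] [Nonempty X] (ν : Measure (X × Y)) (y : Y) : Measure X := by
  classical
  by_cases h : IsFiniteMeasure (ν.map Prod.swap)
  · exact (ν.map Prod.swap).condKernel y
  · exact 0

lemma ofDigits_small {K M : ℕ} (hM : 0 < M) (a : ℕ → Fin M) (ha : ∀ i, (a i : ℕ) < K) :
    Real.ofDigits a ≤ K / M := by
  rw [Real.ofDigits_eq_sum_add_ofDigits a 1]
  have h1 := Real.ofDigits_le_one (fun i ↦ a (i + 1))
  have h2 : ((a 0 : ℕ) : ℝ) + 1 ≤ K := by exact_mod_cast ha 0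
  have hM' : (0 : ℝ) < M := by exact_mod_cast hM
  simp only [Finset.range_one, Finset.sum_singleton, Real.ofDigitsTerm, zero_add, pow_one]
  rw [le_div_iff₀ hM', add_mul, mul_assoc, inv_mul_cancel₀ hM'.ne', mul_right_comm,
    inv_mul_cancel₀ hM'.ne']
  linarith

lemma ofDigits_sep {K M : ℕ} (hK : 2 * K ≤ M) (hM : 0 < M) (a b : ℕ → Fin M)
    (ha : ∀ i, (a i : ℕ) < K) (hb : ∀ i, (b i : ℕ) < K) (L : ℕ)
    (hL : ∀ i < L, a i = b i) (hne : a L ≠ b L) :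
    ((M : ℝ) ^ (L + 1))⁻¹ / 2 ≤ |Real.ofDigits a - Real.ofDigits b| := by
  have hM' : (0 : ℝ) < M := by exact_mod_cast hM
  rw [Real.ofDigits_eq_sum_add_ofDigits a (L + 1), Real.ofDigits_eq_sum_add_ofDigits b (L + 1),
    Finset.sum_range_succ, Finset.sum_range_succ]
  have : ∑ i ∈ Finset.range L, Real.ofDigitsTerm a i
      = ∑ i ∈ Finset.range L, Real.ofDigitsTerm b i :=
    Finset.sum_congr rfl fun i hi ↦ by simp [Real.ofDigitsTerm, hL i (Finset.mem_range.mp hi)]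
  rw [this]
  set A := Real.ofDigits (fun i ↦ a (i + (L + 1)))
  set B := Real.ofDigits (fun i ↦ b (i + (L + 1)))
  have hA : A ≤ K / M := ofDigits_small hM _ (fun i => ha _)
  have hB : B ≤ K / M := ofDigits_small hM _ (fun i => hb _)
  have hA0 : 0 ≤ A := Real.ofDigits_nonneg _
  have hB0 : 0 ≤ B := Real.ofDigits_nonneg _
  have hKM : (K : ℝ) / M ≤ 1 / 2 := by
    rw [div_le_div_iff₀ hM' two_pos]
    have : (2 : ℝ) * K ≤ M := by exact_mod_cast hK
    linarith
  simp only [Real.ofDigitsTerm]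
  set P := ((M : ℝ) ^ (L + 1))⁻¹
  have hP : 0 < P := by positivity
  have e : ∀ s u v : ℝ, s + u * P + P * A - (s + v * P + P * B) = P * ((u - v) + (A - B)) := by
    intros; ring
  rw [e, abs_mul, abs_of_pos hP, div_eq_mul_inv]
  gcongr
  have h1 : (1 : ℝ) ≤ |((a L : ℕ) : ℝ) - ((b L : ℕ) : ℝ)| := by
    have : ((a L : ℕ) : ℤ) - ((b L : ℕ) : ℤ) ≠ 0 := by
      intro h
      apply hne
      apply Fin.ext
      omega
    exact_mod_cast Int.one_le_abs this
  have h2 : |A - B| ≤ 1 / 2 := by rw [abs_le]; constructor <;> linarith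
  have h3 := abs_sub_abs_le_abs_sub (((a L : ℕ) : ℝ) - ((b L : ℕ) : ℝ)) (-(A - B))
  rw [abs_neg, sub_neg_eq_add] at h3
  linarith

/-- the base change map -/
noncomputable def psiMap (K M : ℕ) [NeZero K] (h : K ≤ M) (t : ℝ) : ℝ :=
  Real.ofDigits (fun i => Fin.castLE h (Real.digits t K i))

lemma measurable_psiMap (K M : ℕ) [NeZero K] (h : K ≤ M) : Measurable (psiMap K M h) := by
  unfold psiMap
  refine Real.continuous_ofDigits.measurable.comp ?_
  refine measurable_pi_lambda _ fun i => ?_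
  unfold Real.digits
  exact (measurable_from_top (f := fun k : ℕ => Fin.castLE h (Fin.ofNat K k))).comp
    (Nat.measurable_floor.comp (measurable_id.mul_const _))

lemma psiMap_holder {K M : ℕ} [NeZero K] (hK1 : 1 < K) (hK : 2 * K ≤ M) (h : K ≤ M) (s : ℝ)
    (hs : 0 < s) (hKs : (K : ℝ) = (M : ℝ) ^ s) {t t' : ℝ} (ht : t ∈ Ico (0 : ℝ) 1)
    (ht' : t' ∈ Ico (0 : ℝ) 1) :
    |t - t'| ≤ (2 * M : ℝ) ^ s * |psiMap K M h t - psiMap K M h t'| ^ s := by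
  classical
  have hM : 0 < M := by omega
  have hM' : (0 : ℝ) < M := by exact_mod_cast hM
  by_cases heq : Real.digits t K = Real.digits t' K
  · have : t = t' := by
      rw [← Real.ofDigits_digits hK1 ht, ← Real.ofDigits_digits hK1 ht', heq]
    rw [this, sub_self, abs_zero]
    positivity
  have hex : ∃ i, Real.digits t K i ≠ Real.digits t' K i := by
    by_contra hcon
    push Not at hcon
    exact heq (funext hcon)
  set L := Nat.find hex
  have hL : ∀ i < L, Real.digits t K i = Real.digits t' K i := fun i hi => by
    simpa using Nat.find_min hex hi
  have hne := Nat.find_spec hex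
  have h1 : |t - t'| ≤ ((K : ℝ) ^ L)⁻¹ := by
    have := Real.abs_ofDigits_sub_ofDigits_le hL
    rwa [Real.ofDigits_digits hK1 ht, Real.ofDigits_digits hK1 ht'] at this
  have h2 : ((M : ℝ) ^ (L + 1))⁻¹ / 2 ≤ |psiMap K M h t - psiMap K M h t'| := by
    refine ofDigits_sep hK hM _ _ (fun i => ?_) (fun i => ?_) L (fun i hi => ?_) ?_
    · simp
    · simp
    · rw [hL i hi]
    · intro hh
      exact hne (Fin.castLE_injective h hh)
  calc |t - t'| ≤ ((K : ℝ) ^ L)⁻¹ := h1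
    _ = (2 * M * (((M : ℝ) ^ (L + 1))⁻¹ / 2)) ^ s := by
      have : 2 * M * (((M : ℝ) ^ (L + 1))⁻¹ / 2) = ((M : ℝ) ^ L)⁻¹ := by
        rw [pow_succ]; field_simp
      rw [this, hKs, Real.inv_rpow (by positivity), ← Real.rpow_natCast, ← Real.rpow_natCast,
        ← Real.rpow_mul hM'.le, ← Real.rpow_mul hM'.le, mul_comm]
    _ ≤ (2 * M * |psiMap K M h t - psiMap K M h t'|) ^ s := by gcongr
    _ = _ := by rw [Real.mul_rpow (by positivity) (by positivity)]

lemma psiMap_mem {K M : ℕ} [NeZero K] (hM : 0 < M) (h : K ≤ M) (t : ℝ) :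
    psiMap K M h t ∈ Icc (0 : ℝ) (K / M) :=
  ⟨Real.ofDigits_nonneg _, ofDigits_small hM _ (fun i => by simp)⟩

lemma psiMap_shift {K M : ℕ} [NeZero K] (hM : 0 < M) (h : K ≤ M) (t : ℝ) (k : ℕ) :
    ∃ (z : ℤ), ∃ u ∈ Icc (0 : ℝ) (K / M), (M : ℝ) ^ k * psiMap K M h t = z + u := by
  unfold psiMap
  set a : ℕ → Fin M := fun i => Fin.castLE h (Real.digits t K i) with ha
  have hM' : (0 : ℝ) < M := by exact_mod_cast hM
  refine ⟨∑ i ∈ Finset.range k, (a i : ℕ) * (M : ℤ) ^ (k - (i + 1)),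
    Real.ofDigits (fun i => a (i + k)),
    ⟨Real.ofDigits_nonneg _, ofDigits_small hM _ (fun i => by simp [ha])⟩, ?_⟩
  rw [Real.ofDigits_eq_sum_add_ofDigits a k, mul_add, ← mul_assoc,
    mul_inv_cancel₀ (by positivity), one_mul, Finset.mul_sum]
  push_cast
  congr 1
  refine Finset.sum_congr rfl fun i hi => ?_
  have : k = (k - (i + 1)) + (i + 1) := by have := Finset.mem_range.mp hi; omega
  simp only [Real.ofDigitsTerm]
  conv_lhs => rw [this, pow_add]
  field_simp

lemma circle_dist {x y : ℝ} (h : |x - y| ≤ 1 / 2) :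
    dist (x : UnitAddCircle) (y : UnitAddCircle) = |x - y| := by
  rw [dist_eq_norm, ← AddCircle.coe_sub]
  exact (AddCircle.norm_coe_eq_abs_iff (1 : ℝ) one_ne_zero).mpr (by simpa using h)

lemma norm_fourier_apply (n : ℤ) (x : UnitAddCircle) : ‖(fourier n x : ℂ)‖ = 1 := by
  rw [fourier_apply]; exact Circle.norm_coe _

lemma fourier_re_ge (j : ℤ) {K M : ℕ} [NeZero K] (hM : 0 < M) (h : K ≤ M)
    (hj : 6 * |(j : ℝ)| * (K / M) ≤ 1) (t : ℝ) (k : ℕ) :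
    1 / 2 ≤ (fourier (j * (M : ℤ) ^ k) ((psiMap K M h t : ℝ) : UnitAddCircle)).re := by
  obtain ⟨z, u, ⟨hu0, hu1⟩, hzu⟩ := psiMap_shift hM h t k
  rw [fourier_coe_apply]
  have : (2 * Real.pi * Complex.I * ((j * (M : ℤ) ^ k : ℤ) : ℂ) * (psiMap K M h t : ℂ) / (1 : ℝ))
      = ((2 * Real.pi * (j * u) : ℝ) : ℂ) * Complex.I + ((j * z : ℤ) : ℂ) * (2 * Real.pi * Complex.I) := by
    have e : ((M : ℂ) ^ k * (psiMap K M h t : ℂ)) = z + u := by exact_mod_cast hzu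
    push_cast
    linear_combination (2 * Real.pi * Complex.I * j) * e
  rw [this, Complex.exp_periodic.int_mul, Complex.exp_ofReal_mul_I_re, ← Real.cos_pi_div_three,
    ← Real.cos_abs (2 * Real.pi * (j * u))]
  apply Real.cos_le_cos_of_nonneg_of_le_pi (abs_nonneg _)
  · linarith [Real.pi_pos]
  · rw [abs_mul, abs_mul (j : ℝ), abs_of_nonneg hu0, abs_of_pos (by positivity)]
    have : 6 * (|(j : ℝ)| * u) ≤ 1 := by
      refine le_trans ?_ hj
      rw [mul_assoc]
      gcongr
    nlinarith [Real.pi_pos]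

/-- the Cantor-like measure -/
noncomputable def tauMeasure (K M : ℕ) [NeZero K] (h : K ≤ M) : Measure UnitAddCircle :=
  (volume.restrict (Ico (0 : ℝ) 1)).map (fun t => ((psiMap K M h t : ℝ) : UnitAddCircle))

lemma measurable_psiC (K M : ℕ) [NeZero K] (h : K ≤ M) :
    Measurable (fun t => ((psiMap K M h t : ℝ) : UnitAddCircle)) :=
  (AddCircle.measurable_mk').comp (measurable_psiMap K M h)

instance (K M : ℕ) [NeZero K] (h : K ≤ M) : IsProbabilityMeasure (tauMeasure K M h) := by
  have : IsProbabilityMeasure (volume.restrict (Ico (0 : ℝ) 1)) := ⟨by simp⟩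
  exact Measure.isProbabilityMeasure_map (measurable_psiC K M h).aemeasurable

lemma tau_dim {K M : ℕ} [NeZero K] (hK1 : 1 < K) (hK : 2 * K ≤ M) (h : K ≤ M) (s : NNReal)
    (hs : 0 < s) (hKs : (K : ℝ) = (M : ℝ) ^ (s : ℝ)) : (s : ℝ≥0∞) ≤ measureDim (tauMeasure K M h) := by
  have hM : 0 < M := by omega
  have hM' : (0 : ℝ) < M := by exact_mod_cast hM
  unfold measureDim
  refine le_iInf fun A => le_iInf fun hA => le_iInf fun hpos => ?_
  unfold tauMeasure at hpos
  rw [Measure.map_apply (measurable_psiC K M h) hA,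
    Measure.restrict_apply (measurable_psiC K M h hA)] at hpos
  set f : ℝ → UnitAddCircle := (fun t => ((psiMap K M h t : ℝ) : UnitAddCircle))
  set E := f ⁻¹' A ∩ Ico (0 : ℝ) 1
  have hd1 : (1 : ℝ≥0∞) ≤ dimH E := by
    have : μH[((1 : NNReal) : ℝ)] E ≠ 0 := by
      rw [NNReal.coe_one, hausdorffMeasure_real]; exact hpos.ne'
    simpa using le_dimH_of_hausdorffMeasure_ne_zero this
  have hmain : ∀ t ∈ E, ∀ t' ∈ E, |t - t'| ≤ (2 * M : ℝ) ^ (s : ℝ) * dist (f t) (f t') ^ (s : ℝ) := by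
    intro t ht t' ht'
    have h1 := psiMap_mem hM h t
    have h2 := psiMap_mem hM h t'
    have hKM : (K : ℝ) / M ≤ 1 / 2 := by
      rw [div_le_div_iff₀ hM' two_pos]
      have : (2 : ℝ) * K ≤ M := by exact_mod_cast hK
      linarith
    rw [circle_dist]
    · exact psiMap_holder hK1 hK h s hs hKs ht.2 ht'.2
    · rw [abs_le]
      constructor <;> linarith [h1.1, h1.2, h2.1, h2.2]
  have hinj : InjOn f E := by
    intro t ht t' ht' he
    have := hmain t ht t' ht'
    rw [he, dist_self, Real.zero_rpow (by exact_mod_cast hs.ne'), mul_zero] at this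
    exact sub_eq_zero.mp (abs_nonpos_iff.mp this)
  set g := Function.invFunOn f E
  have hg : ∀ t ∈ E, g (f t) = t := fun t ht => hinj.leftInvOn_invFunOn ht
  have hH : HolderOnWith (Real.toNNReal ((2 * M : ℝ) ^ (s : ℝ))) s g (f '' E) := by
    rintro _ ⟨t, ht, rfl⟩ _ ⟨t', ht', rfl⟩
    rw [hg t ht, hg t' ht', edist_dist, edist_dist, Real.dist_eq]
    refine (ENNReal.ofReal_le_ofReal (hmain t ht t' ht')).trans ?_
    rw [ENNReal.ofReal_mul (by positivity),
      ← ENNReal.ofReal_rpow_of_nonneg (dist_nonneg (x := f t) (y := f t')) s.coe_nonneg]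
    rfl
  have h3 := hH.dimH_image_le hs
  have h4 : g '' (f '' E) = E := by
    rw [← image_comp]
    exact (image_congr (fun t ht => hg t ht)).trans (image_id E)
  rw [h4] at h3
  have h5 : dimH (f '' E) ≤ dimH A := dimH_mono (by rintro _ ⟨t, ht, rfl⟩; exact ht.1)
  have h6 : (1 : ℝ≥0∞) ≤ dimH A / s := hd1.trans (h3.trans (by gcongr))
  rwa [ENNReal.le_div_iff_mul_le (by simp [hs.ne']) (by simp), one_mul] at h6

lemma exists_tau (m : ℕ) (hm : 2 ≤ m) (j : ℤ) (δ : ℝ≥0∞) (hδ : 0 < δ) :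
    ∃ q : ℕ, 0 < q ∧ ∃ τ : Measure UnitAddCircle, IsProbabilityMeasure τ ∧
      1 - δ ≤ measureDim τ ∧
      ∀ k : ℕ, 1 / 2 ≤ ‖∫ x, fourier (j * ((m ^ q : ℕ) : ℤ) ^ k) x ∂τ‖ := by
  set r := 6 * j.natAbs + 1
  have hmr : r < m ^ r := Nat.lt_pow_self (by omega)
  obtain ⟨p, hp⟩ := ENNReal.exists_nat_gt (r := r / δ) (ENNReal.div_ne_top (by simp) hδ.ne')
  set q := p + r + 1
  set K := m ^ (q - r)
  set M := m ^ q
  have hMK : M = K * m ^ r := by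
    rw [← pow_add, Nat.sub_add_cancel (by omega)]
  have hK1 : 1 < K := Nat.one_lt_pow (by omega) (by omega)
  have : NeZero K := ⟨by omega⟩
  have hr2 : 2 ≤ m ^ r := by
    calc 2 ≤ m := hm
      _ ≤ m ^ r := Nat.le_self_pow (by omega) m
  have hK : 2 * K ≤ M := by rw [hMK, mul_comm]; gcongr
  have h : K ≤ M := by omega
  have hq0 : (0 : ℝ) < q := by positivity
  have hM : 0 < M := by omega
  let s : NNReal := ((q - r : ℕ) : NNReal) / q
  have hs : 0 < s := by
    apply div_pos
    · have : 0 < q - r := by omega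
      exact_mod_cast this
    · have : 0 < q := by omega
      exact_mod_cast this
  have hKs : (K : ℝ) = (M : ℝ) ^ (s : ℝ) := by
    simp only [K, M, s]
    rw [NNReal.coe_div, NNReal.coe_natCast, NNReal.coe_natCast, Nat.cast_pow, Nat.cast_pow,
      ← Real.rpow_natCast (m : ℝ) q, ← Real.rpow_mul (by positivity), mul_div_cancel₀ _ hq0.ne',
      Real.rpow_natCast]
  refine ⟨q, by omega, tauMeasure K M h, inferInstance, ?_, fun k => ?_⟩
  · refine le_trans ?_ (tau_dim hK1 hK h s hs hKs)
    rw [tsub_le_iff_right]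
    have hd : (r : ℝ≥0∞) / q ≤ δ := by
      rw [ENNReal.div_le_iff (by simp [q]) (by simp), mul_comm]
      have := (ENNReal.div_lt_iff (Or.inl hδ.ne') (Or.inr (ENNReal.natCast_ne_top r))).mp hp
      refine this.le.trans ?_
      gcongr
      omega
    calc (1 : ℝ≥0∞) = s + r / q := by
          have : (1 : NNReal) = s + r / q := by
            rw [← add_div, ← Nat.cast_add, Nat.sub_add_cancel (by omega), div_self]
            simp [q]
          have h0 : (q : NNReal) ≠ 0 := by simp [q]
          have h2 : (r : ℝ≥0∞) / q = ((r / q : NNReal) : ℝ≥0∞) := by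
            rw [ENNReal.coe_div h0]; simp
          rw [h2]
          exact_mod_cast this
      _ ≤ s + δ := by gcongr
  · refine le_trans ?_ (Complex.re_le_norm _)
    have hIntg : Integrable (fun x : UnitAddCircle => (fourier (j * (M : ℤ) ^ k) x : ℂ))
        (tauMeasure K M h) := (fourier _).continuous.integrable_of_hasCompactSupport
          (HasCompactSupport.of_compactSpace _)
    have : (∫ x, (fourier (j * (M : ℤ) ^ k) x : ℂ) ∂(tauMeasure K M h)).re
        = ∫ x, (fourier (j * (M : ℤ) ^ k) x : ℂ).re ∂(tauMeasure K M h) := (integral_re hIntg).symm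
    rw [this]
    unfold tauMeasure
    rw [integral_map (measurable_psiC K M h).aemeasurable
      (by exact (Complex.continuous_re.comp (fourier _).continuous).aestronglyMeasurable)]
    have hprob : IsProbabilityMeasure (volume.restrict (Ico (0 : ℝ) 1)) := ⟨by simp⟩
    have hj6 : 6 * |(j : ℝ)| * (K / M) ≤ 1 := by
      have e : (K : ℝ) / M = ((m : ℝ) ^ r)⁻¹ := by
        rw [hMK]; push_cast
        have : (K : ℝ) ≠ 0 := by exact_mod_cast (by omega : K ≠ 0)
        field_simp
      rw [e, ← div_eq_mul_inv, div_le_one (by positivity)]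
      have : ((6 * j.natAbs : ℕ) : ℝ) ≤ ((m ^ r : ℕ) : ℝ) := by
        exact_mod_cast (by omega : 6 * j.natAbs ≤ m ^ r)
      push_cast at this
      rwa [Nat.cast_natAbs, Int.cast_abs] at this
    calc (1 / 2 : ℝ) = ∫ t in Ico (0 : ℝ) 1, (1 / 2 : ℝ) := by simp
      _ ≤ _ := by
        refine integral_mono (integrable_const _) ?_ (fun t => fourier_re_ge j hM h hj6 t k)
        refine Integrable.of_bound (C := 1) ?_ ?_
        · exact ((Complex.continuous_re.comp (fourier _).continuous).measurable.comp
            (measurable_psiC K M h)).aestronglyMeasurable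
        · refine Eventually.of_forall fun t => ?_
          refine (Complex.abs_re_le_norm _).trans ?_
          exact (norm_fourier_apply _ _).le
lemma integrable_circle {μ : Measure UnitAddCircle} [IsFiniteMeasure μ] {f : UnitAddCircle → ℂ}
    (hf : Continuous f) : Integrable f μ :=
  hf.integrable_of_hasCompactSupport (HasCompactSupport.of_compactSpace _)

lemma integral_fourier_eq_zero {n : ℤ} (hn : n ≠ 0) :
    ∫ x : UnitAddCircle, (fourier n x : ℂ) = 0 :=
  integral_eq_zero_of_add_right_eq_neg (fourier_add_half_inv_index hn one_pos)

/-- Riesz product -/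
noncomputable def rieszP (a : ℕ → ℂ) (j : ℤ) (M : ℕ) (t : ℝ) (N : ℕ) (x : UnitAddCircle) : ℝ :=
  ∏ k ∈ Finset.range N, (1 + t * (a k * fourier (j * (M : ℤ) ^ k) x).re)

/-- exponential sum -/
noncomputable def expSum (a : ℕ → ℂ) (j : ℤ) (M : ℕ) (N : ℕ) (x : UnitAddCircle) : ℝ :=
  ∑ k ∈ Finset.range N, (a k * fourier (j * (M : ℤ) ^ k) x).re

lemma continuous_rieszP (a : ℕ → ℂ) (j : ℤ) (M : ℕ) (t : ℝ) (N : ℕ) :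
    Continuous (rieszP a j M t N) := by
  unfold rieszP
  fun_prop

lemma continuous_expSum (a : ℕ → ℂ) (j : ℤ) (M : ℕ) (N : ℕ) :
    Continuous (expSum a j M N) := by
  unfold expSum
  fun_prop

lemma rieszP_integral (a : ℕ → ℂ) {j : ℤ} (hj : j ≠ 0) {M : ℕ} (hM : 2 ≤ M) (t : ℝ) (N : ℕ) :
    (∫ x : UnitAddCircle, (rieszP a j M t N x : ℂ)) = 1 ∧
    ∀ r : ℤ, (M : ℤ) ^ N ≤ |r| →
      ∫ x : UnitAddCircle, (rieszP a j M t N x : ℂ) * fourier (j * r) x = 0 := by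
  induction N with
  | zero =>
    refine ⟨by simp [rieszP, measureReal_def, UnitAddCircle.measure_univ], fun r hr => ?_⟩
    have hr0 : r ≠ 0 := by rintro rfl; simp at hr
    simpa [rieszP] using integral_fourier_eq_zero (mul_ne_zero hj hr0)
  | succ N ih =>
    obtain ⟨ih1, ih2⟩ := ih
    have hP : ∀ x, (rieszP a j M t (N + 1) x : ℂ) = rieszP a j M t N x +
        (t / 2 * a N) * (rieszP a j M t N x * fourier (j * (M : ℤ) ^ N) x) +
        (t / 2 * (starRingEnd ℂ (a N))) * (rieszP a j M t N x * fourier (j * -(M : ℤ) ^ N) x) := by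
      intro x
      have h1 : rieszP a j M t (N + 1) x
        = rieszP a j M t N x * (1 + t * (a N * fourier (j * (M : ℤ) ^ N) x).re) := by
        simp only [rieszP, Finset.prod_range_succ]
      rw [h1, mul_neg, fourier_neg]
      push_cast
      rw [Complex.re_eq_add_conj, map_mul]
      ring
    have hc : Continuous fun x => (rieszP a j M t N x : ℂ) :=
      Complex.continuous_ofReal.comp (continuous_rieszP a j M t N)
    have hi : ∀ r : ℤ, Integrable (fun x : UnitAddCircle => (rieszP a j M t N x : ℂ) *
        (fourier r x : ℂ)) := fun r => integrable_circle (hc.mul (fourier r).continuous)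
    have hpos : (0 : ℤ) ≤ (M : ℤ) ^ N := by positivity
    constructor
    · simp_rw [hP]
      rw [integral_add, integral_add, integral_const_mul, integral_const_mul, ih1, ih2, ih2]
      · simp
      · rw [abs_neg]; exact le_abs_self _
      · exact le_abs_self _
      · exact integrable_circle hc
      · exact (hi _).const_mul _
      · exact (integrable_circle hc).add ((hi _).const_mul _)
      · exact (hi _).const_mul _
    · intro r hr
      have hr2 : 2 * (M : ℤ) ^ N ≤ |r| := by
        refine le_trans ?_ hr
        rw [pow_succ, mul_comm]
        gcongr
        exact_mod_cast hM
      have hQ : ∀ x, (rieszP a j M t (N + 1) x : ℂ) * fourier (j * r) x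
        = rieszP a j M t N x * fourier (j * r) x +
        (t / 2 * a N) * (rieszP a j M t N x * fourier (j * ((M : ℤ) ^ N + r)) x) +
        (t / 2 * (starRingEnd ℂ (a N))) *
          (rieszP a j M t N x * fourier (j * (-(M : ℤ) ^ N + r)) x) := by
        intro x
        rw [hP, mul_add j, mul_add j, fourier_add, fourier_add]
        ring
      simp_rw [hQ]
      rw [integral_add, integral_add, integral_const_mul, integral_const_mul, ih2, ih2, ih2]
      · simp
      · have h1 := abs_sub_abs_le_abs_sub r ((M : ℤ) ^ N)
        rw [abs_of_nonneg hpos] at h1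
        rw [neg_add_eq_sub]; linarith
      · have h1 := abs_sub_abs_le_abs_sub r (-(M : ℤ) ^ N)
        rw [abs_neg, abs_of_nonneg hpos, sub_neg_eq_add] at h1
        rw [add_comm]; linarith
      · linarith
      · exact hi _
      · exact (hi _).const_mul _
      · exact (hi _).add ((hi _).const_mul _)
      · exact (hi _).const_mul _

lemma exp_le_aux {t v : ℝ} (ht : t ≤ 1 / 2) (hv : |v| ≤ t) :
    Real.exp v ≤ (1 + v) * Real.exp (2 * t ^ 2) := by
  have h1 := Real.abs_exp_sub_one_sub_id_le (x := v) (by linarith)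
  have h2 := (abs_le.mp h1).2
  have h3 := Real.add_one_le_exp (2 * t ^ 2)
  obtain ⟨h4, h5⟩ := abs_le.mp hv
  have h6 : v ^ 2 ≤ t ^ 2 := sq_le_sq' h4 h5
  have h7 : (1 + v) * (2 * t ^ 2 + 1) ≤ (1 + v) * Real.exp (2 * t ^ 2) := by
    gcongr; linarith
  have h8 : 0 ≤ (1 + 2 * v) * t ^ 2 := by
    apply mul_nonneg _ (sq_nonneg t); linarith
  nlinarith

lemma integral_exp_expSum {a : ℕ → ℂ} (ha : ∀ k, ‖a k‖ ≤ 1) {j : ℤ} (hj : j ≠ 0) {M : ℕ}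
    (hM : 2 ≤ M) {t : ℝ} (ht0 : 0 ≤ t) (ht : t ≤ 1 / 2) (N : ℕ) :
    ∫ x : UnitAddCircle, Real.exp (t * expSum a j M N x) ≤ Real.exp (2 * t ^ 2 * N) := by
  have hle : ∀ x, Real.exp (t * expSum a j M N x)
      ≤ rieszP a j M t N x * Real.exp (2 * t ^ 2 * N) := by
    intro x
    have : Real.exp (2 * t ^ 2 * N) = ∏ k ∈ Finset.range N, Real.exp (2 * t ^ 2) := by
      rw [Finset.prod_const, Finset.card_range, ← Real.exp_nat_mul, mul_comm]
    rw [this, rieszP, ← Finset.prod_mul_distrib, expSum, Finset.mul_sum, Real.exp_sum]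
    refine Finset.prod_le_prod (fun _ _ => (Real.exp_pos _).le) fun k _ => exp_le_aux ht ?_
    rw [abs_mul, abs_of_nonneg ht0]
    refine mul_le_of_le_one_right ht0 ((Complex.abs_re_le_norm _).trans ?_)
    rw [norm_mul, norm_fourier_apply, mul_one]
    exact ha k
  have hci : ∀ {f : UnitAddCircle → ℝ}, Continuous f → Integrable f := fun hf =>
    hf.integrable_of_hasCompactSupport (HasCompactSupport.of_compactSpace _)
  have h1 : ∫ x : UnitAddCircle, rieszP a j M t N x = 1 := by
    have := (rieszP_integral a hj hM t N).1
    rw [integral_complex_ofReal] at this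
    exact_mod_cast this
  calc _ ≤ ∫ x : UnitAddCircle, rieszP a j M t N x * Real.exp (2 * t ^ 2 * N) := by
        refine integral_mono (hci ?_) (hci ?_) hle
        · exact Real.continuous_exp.comp (continuous_const.mul (continuous_expSum a j M N))
        · exact (continuous_rieszP a j M t N).mul continuous_const
    _ = _ := by rw [integral_mul_const, h1, one_mul]

lemma deviation {a : ℕ → ℂ} (ha : ∀ k, ‖a k‖ ≤ 1) {j : ℤ} (hj : j ≠ 0) {M : ℕ}
    (hM : 2 ≤ M) {η : ℝ} (hη : 0 < η) (hη1 : η ≤ 1) (N : ℕ) :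
    (volume : Measure UnitAddCircle).real {x | η * N ≤ expSum a j M N x}
      ≤ Real.exp (-(η ^ 2 / 8) * N) := by
  have h1 := integral_exp_expSum ha hj hM (t := η / 4) (by linarith) (by linarith) N
  have hcont : Continuous fun x => Real.exp (η / 4 * expSum a j M N x) :=
    Real.continuous_exp.comp (continuous_const.mul (continuous_expSum a j M N))
  have h2 := mul_meas_ge_le_integral_of_nonneg (μ := (volume : Measure UnitAddCircle))
    (f := fun x => Real.exp (η / 4 * expSum a j M N x))
    (Eventually.of_forall fun x => (Real.exp_pos _).le)
    (hcont.integrable_of_hasCompactSupport (HasCompactSupport.of_compactSpace _))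
    (Real.exp (η / 4 * (η * N)))
  have h3 : {x : UnitAddCircle | Real.exp (η / 4 * (η * N)) ≤ Real.exp (η / 4 * expSum a j M N x)}
      = {x | η * N ≤ expSum a j M N x} := by
    ext x
    simp only [mem_ofPred_eq, Real.exp_le_exp]
    exact mul_le_mul_iff_right₀ (by linarith)
  rw [h3] at h2
  have h4 := h2.trans h1
  rw [← le_div_iff₀' (Real.exp_pos _), ← Real.exp_sub] at h4
  refine h4.trans (le_of_eq ?_)
  congr 1
  ring

lemma expSum_lip {a : ℕ → ℂ} (ha : ∀ k, ‖a k‖ ≤ 1) (j : ℤ) {M : ℕ}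
    (hM : 2 ≤ M) (N : ℕ) {x y : ℝ} (hxy : |x - y| ≤ ((M : ℝ) ^ N)⁻¹) :
    expSum a j M N (x : UnitAddCircle) - 2 * Real.pi * |(j : ℝ)|
      ≤ expSum a j M N (y : UnitAddCircle) := by
  have hM' : (0 : ℝ) < M := by exact_mod_cast (by omega : 0 < M)
  have hf : ∀ n : ℤ, ‖(fourier n (x : UnitAddCircle) : ℂ) - fourier n (y : UnitAddCircle)‖
      ≤ 2 * Real.pi * |(n : ℝ)| * |x - y| := by
    intro n
    have e1 : (fourier n (x : UnitAddCircle) : ℂ) - fourier n (y : UnitAddCircle)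
      = fourier n (y : UnitAddCircle) *
        (Complex.exp (Complex.I * ((2 * Real.pi * n * (x - y) : ℝ) : ℂ)) - 1) := by
      rw [mul_sub, mul_one, fourier_coe_apply, fourier_coe_apply, ← Complex.exp_add]
      congr 2
      push_cast
      ring
    rw [e1, norm_mul, norm_fourier_apply, one_mul]
    refine (Real.norm_exp_I_mul_ofReal_sub_one_le).trans (le_of_eq ?_)
    rw [Real.norm_eq_abs, abs_mul, abs_mul, abs_of_pos (a := 2 * Real.pi) (by positivity)]
  have hsum : ∑ k ∈ Finset.range N, (M : ℝ) ^ k ≤ (M : ℝ) ^ N := by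
    have : ∑ k ∈ Finset.range N, M ^ k < M ^ N := Nat.geomSum_lt hM (fun k hk => by simpa using hk)
    exact_mod_cast this.le
  have : expSum a j M N (x : UnitAddCircle) - expSum a j M N (y : UnitAddCircle)
      ≤ 2 * Real.pi * |(j : ℝ)| := by
    unfold expSum
    rw [← Finset.sum_sub_distrib]
    calc _ ≤ ∑ k ∈ Finset.range N, (2 * Real.pi * |(j : ℝ)| * ((M : ℝ) ^ N)⁻¹) * (M : ℝ) ^ k := by
          refine Finset.sum_le_sum fun k _ => ?_
          rw [← Complex.sub_re, ← mul_sub]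
          refine (Complex.re_le_norm _).trans ?_
          rw [norm_mul]
          refine (mul_le_of_le_one_left (norm_nonneg _) (ha k)).trans ((hf _).trans ?_)
          push_cast
          rw [abs_mul, abs_of_pos (a := (M : ℝ) ^ k) (by positivity)]
          calc 2 * Real.pi * (|(j : ℝ)| * (M : ℝ) ^ k) * |x - y|
            ≤ 2 * Real.pi * (|(j : ℝ)| * (M : ℝ) ^ k) * ((M : ℝ) ^ N)⁻¹ := by gcongr
            _ = _ := by ring
      _ = (2 * Real.pi * |(j : ℝ)| * ((M : ℝ) ^ N)⁻¹) * ∑ k ∈ Finset.range N, (M : ℝ) ^ k := by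
          rw [Finset.mul_sum]
      _ ≤ (2 * Real.pi * |(j : ℝ)| * ((M : ℝ) ^ N)⁻¹) * (M : ℝ) ^ N := by gcongr
      _ = _ := by field_simp
  linarith

/-- M-adic interval -/
def madic (M N i : ℕ) : Set ℝ := Ico ((i : ℝ) / (M : ℝ) ^ N) (((i : ℝ) + 1) / (M : ℝ) ^ N)

lemma mem_madic {M : ℕ} (hM : 2 ≤ M) (N i : ℕ) (x : ℝ) :
    x ∈ madic M N i ↔ (0 ≤ x ∧ ⌊x * (M : ℝ) ^ N⌋₊ = i) := by
  have hM' : (0 : ℝ) < (M : ℝ) ^ N := by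
    have : (0 : ℝ) < M := by exact_mod_cast (by omega : 0 < M)
    positivity
  unfold madic
  rw [mem_Ico, div_le_iff₀ hM', lt_div_iff₀ hM']
  constructor
  · rintro ⟨h1, h2⟩
    have : 0 ≤ x * (M : ℝ) ^ N := le_trans (by positivity) h1
    exact ⟨nonneg_of_mul_nonneg_left this hM', (Nat.floor_eq_iff this).mpr ⟨h1, h2⟩⟩
  · rintro ⟨h0, h⟩
    exact (Nat.floor_eq_iff (by positivity)).mp h

open Classical in
/-- the M-adic intervals that meet the deviation set -/
noncomputable def hits (a : ℕ → ℂ) (j : ℤ) (M : ℕ) (ε : ℝ) (N : ℕ) : Finset ℕ :=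
  (Finset.range (M ^ N)).filter
    (fun i => ∃ x ∈ madic M N i, ε * N ≤ expSum a j M N (x : UnitAddCircle))

lemma volume_madic {M : ℕ} (hM : 2 ≤ M) (N i : ℕ) :
    volume (madic M N i) = ENNReal.ofReal ((M : ℝ) ^ N)⁻¹ := by
  unfold madic
  rw [Real.volume_Ico]
  congr 1
  ring

lemma card_hits {a : ℕ → ℂ} (ha : ∀ k, ‖a k‖ ≤ 1) {j : ℤ} (hj : j ≠ 0) {M : ℕ}
    (hM : 2 ≤ M) {ε : ℝ} (hε : 0 < ε) (hε1 : ε ≤ 1) {N : ℕ}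
    (hN : 2 * Real.pi * |(j : ℝ)| ≤ ε / 2 * N) :
    ((hits a j M ε N).card : ℝ) * ((M : ℝ) ^ N)⁻¹ ≤ Real.exp (-(ε ^ 2 / 32) * N) := by
  have hM' : (0 : ℝ) < (M : ℝ) ^ N := by
    have : (0 : ℝ) < M := by exact_mod_cast (by omega : 0 < M)
    positivity
  set D : Set UnitAddCircle := {x | ε / 2 * N ≤ expSum a j M N x}
  have hD : MeasurableSet D :=
    measurableSet_le measurable_const (continuous_expSum a j M N).measurable
  have hdev := deviation ha hj hM (η := ε / 2) (by linarith) (by linarith) N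
  have hsub : (⋃ i ∈ hits a j M ε N, madic M N i) ⊆ (fun x : ℝ => (x : UnitAddCircle)) ⁻¹' D ∩ Ico 0 1 := by
    intro y hy
    simp only [mem_iUnion] at hy
    obtain ⟨i, hi, hyi⟩ := hy
    simp only [hits, Finset.mem_filter, Finset.mem_range] at hi
    obtain ⟨hiM, x, hxi, hx⟩ := hi
    refine ⟨?_, ?_⟩
    · have h1 : |x - y| ≤ ((M : ℝ) ^ N)⁻¹ := by
        have e : ((i : ℝ) + 1) / (M : ℝ) ^ N = i / (M : ℝ) ^ N + ((M : ℝ) ^ N)⁻¹ := by ring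
        have hx' := hxi
        have hy' := hyi
        unfold madic at hx' hy'
        rw [e] at hx' hy'
        rw [abs_le]
        constructor <;> linarith [hx'.1, hx'.2, hy'.1, hy'.2]
      have h2 := expSum_lip ha j hM N h1
      show ε / 2 * N ≤ expSum a j M N (y : UnitAddCircle)
      linarith
    · refine ⟨((mem_madic hM N i y).mp hyi).1, hyi.2.trans_le ?_⟩
      rw [div_le_one hM']
      exact_mod_cast hiM
  have hvol := measure_mono (μ := (volume : Measure ℝ)) hsub
  rw [measure_biUnion_finset] at hvol
  rotate_left
  · intro i _ i' _ hne
    refine Set.disjoint_left.mpr fun x hx hx' => hne ?_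
    rw [← ((mem_madic hM N i x).mp hx).2, ((mem_madic hM N i' x).mp hx').2]
  · intro i _
    exact measurableSet_Ico
  have hmp := (UnitAddCircle.measurePreserving_mk 0).measure_preimage hD.nullMeasurableSet
  rw [zero_add, ← restrict_Ico_eq_restrict_Ioc,
    Measure.restrict_apply (AddCircle.measurable_mk' hD)] at hmp
  rw [hmp] at hvol
  simp only [volume_madic hM, Finset.sum_const, nsmul_eq_mul] at hvol
  have h3 := ENNReal.toReal_mono (measure_ne_top _ _) hvol
  rw [ENNReal.toReal_mul, ENNReal.toReal_natCast, ENNReal.toReal_ofReal (by positivity)] at h3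
  refine h3.trans (hdev.trans (le_of_eq ?_))
  congr 1
  ring

/-- the bad set -/
def badSet (a : ℕ → ℂ) (j : ℤ) (M : ℕ) (ε : ℝ) : Set UnitAddCircle :=
  {x | ∃ᶠ N : ℕ in atTop, ε * N ≤ expSum a j M N x}

lemma dimH_badSet {a : ℕ → ℂ} (ha : ∀ k, ‖a k‖ ≤ 1) {j : ℤ} (hj : j ≠ 0) {M : ℕ}
    (hM : 2 ≤ M) {ε : ℝ} (hε : 0 < ε) (hε1 : ε ≤ 1) : dimH (badSet a j M ε) < 1 := by
  have hM1 : (1 : ℝ) < M := by exact_mod_cast (by omega : 1 < M)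
  have hM0 : (0 : ℝ) < M := by linarith
  have hlog : 0 < Real.log M := Real.log_pos hM1
  set c := ε ^ 2 / 32 with hc
  have hc0 : 0 < c := by positivity
  set u := min (1 / 2) (c / (2 * Real.log M)) with hu
  have hu0 : 0 < u := lt_min (by norm_num) (by positivity)
  have hu1 : u ≤ 1 / 2 := min_le_left _ _
  have hu2 : u * Real.log M ≤ c / 2 := by
    have : u ≤ c / (2 * Real.log M) := min_le_right _ _
    calc u * Real.log M ≤ c / (2 * Real.log M) * Real.log M := by gcongr
      _ = c / 2 := by field_simp
  obtain ⟨s, hs⟩ : ∃ s : NNReal, (s : ℝ) = 1 - u := ⟨⟨1 - u, by linarith⟩, rfl⟩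
  have hs0 : 0 < (s : ℝ) := by linarith
  obtain ⟨N0, hN0⟩ := exists_nat_ge (2 * Real.pi * |(j : ℝ)| / (ε / 2))
  rw [div_le_iff₀' (by positivity)] at hN0
  set θ := Real.exp (-(c / 2)) with hθ
  have hθ0 : 0 < θ := Real.exp_pos _
  have hθ1 : θ < 1 := by rw [hθ, Real.exp_lt_one_iff]; linarith
  set B : Set ℝ := {t | t ∈ Ico (0 : ℝ) 1 ∧ (t : UnitAddCircle) ∈ badSet a j M ε} with hB
  have himg : badSet a j M ε ⊆ (fun t : ℝ => (t : UnitAddCircle)) '' B := by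
    intro x hx
    obtain ⟨t, ht, rfl⟩ := AddCircle.eq_coe_Ico x
    exact ⟨t, ⟨by simpa using ht, hx⟩, rfl⟩
  have hlip : LipschitzWith 1 (fun t : ℝ => (t : UnitAddCircle)) := by
    refine LipschitzWith.of_dist_le_mul fun x y => ?_
    rw [NNReal.coe_one, one_mul, dist_eq_norm, ← AddCircle.coe_sub, Real.dist_eq,
      UnitAddCircle.norm_eq]
    simpa using round_le (x - y) 0
  have hterm : ∀ N, N0 ≤ N →
      ((hits a j M ε N).card : ℝ≥0∞) * (ENNReal.ofReal ((M : ℝ) ^ N)⁻¹) ^ (s : ℝ)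
        ≤ ENNReal.ofReal θ ^ N := by
    intro N hN
    have hMN : (0 : ℝ) < (M : ℝ) ^ N := by positivity
    have h1 := card_hits ha hj hM hε hε1 (N := N) (hN0.trans (by gcongr))
    rw [ENNReal.ofReal_rpow_of_nonneg (by positivity) hs0.le, ← ENNReal.ofReal_natCast,
      ← ENNReal.ofReal_mul (by positivity), ← ENNReal.ofReal_pow hθ0.le]
    apply ENNReal.ofReal_le_ofReal
    have h2 : (((M : ℝ) ^ N)⁻¹) ^ (s : ℝ) = ((M : ℝ) ^ N)⁻¹ * Real.exp (u * Real.log M * N) := by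
      rw [hs, Real.rpow_sub (by positivity), Real.rpow_one, div_eq_mul_inv]
      congr 1
      rw [Real.inv_rpow (by positivity), inv_inv, Real.rpow_def_of_pos hMN, Real.log_pow]
      congr 1
      ring
    rw [h2, ← mul_assoc]
    calc _ ≤ Real.exp (-c * N) * Real.exp (c / 2 * N) := by gcongr
      _ = θ ^ N := by
        rw [← Real.exp_add, hθ, ← Real.exp_nat_mul]
        congr 1
        ring
  have hdiam : ∀ N i, Metric.ediam (madic M N i) = ENNReal.ofReal ((M : ℝ) ^ N)⁻¹ := by
    intro N i
    unfold madic
    rw [Real.ediam_Ico]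
    congr 1
    ring
  have hH : μH[(s : ℝ)] B ≤ ∑' N : ℕ, ENNReal.ofReal θ ^ N := by
    refine (Measure.hausdorffMeasure_le_liminf_tsum (ι := fun n : ℕ => Σ N : ℕ, hits a j M ε (n + N))
      (s : ℝ) B (l := atTop) (fun n : ℕ => ENNReal.ofReal ((M : ℝ) ^ n)⁻¹) ?_
      (fun n p => madic M (n + p.1) p.2) ?_ ?_).trans ?_
    · rw [← ENNReal.ofReal_zero]
      refine ENNReal.tendsto_ofReal ?_
      exact tendsto_inv_atTop_zero.comp (tendsto_pow_atTop_atTop_of_one_lt hM1)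
    · refine Eventually.of_forall fun n p => ?_
      rw [hdiam]
      apply ENNReal.ofReal_le_ofReal
      gcongr
      · exact hM1.le
      · omega
    · refine Eventually.of_forall fun n t ht => ?_
      obtain ⟨ht01, htb⟩ := ht
      obtain ⟨N, hN, hNb⟩ := (frequently_atTop.mp htb) n
      obtain ⟨N', rfl⟩ := Nat.exists_eq_add_of_le hN
      have hmem : t ∈ madic M (n + N') ⌊t * (M : ℝ) ^ (n + N')⌋₊ := by
        rw [mem_madic hM]; exact ⟨ht01.1, rfl⟩
      rw [mem_iUnion]
      refine ⟨⟨N', ⟨⌊t * (M : ℝ) ^ (n + N')⌋₊, ?_⟩⟩, hmem⟩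
      simp only [hits, Finset.mem_filter, Finset.mem_range]
      refine ⟨?_, t, hmem, hNb⟩
      rw [Nat.floor_lt (by have := ht01.1; positivity)]
      push_cast
      exact mul_lt_of_lt_one_left (by positivity) ht01.2
    · refine liminf_le_of_frequently_le' (Eventually.frequently ?_)
      filter_upwards [eventually_ge_atTop N0] with n hn
      rw [ENNReal.tsum_sigma']
      refine ENNReal.tsum_le_tsum fun N => ?_
      simp only [hdiam]
      rw [tsum_fintype, Finset.sum_const, nsmul_eq_mul, Finset.card_univ, Fintype.card_coe]
      refine (hterm (n + N) (by omega)).trans ?_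
      refine pow_le_pow_of_le_one zero_le ?_ (by omega)
      rw [← ENNReal.ofReal_one]
      exact ENNReal.ofReal_le_ofReal hθ1.le
  have hfin : (∑' N : ℕ, ENNReal.ofReal θ ^ N) ≠ ∞ := by
    rw [ENNReal.tsum_geometric]
    refine ENNReal.inv_ne_top.mpr ?_
    rw [Ne, tsub_eq_zero_iff_le, not_le, ← ENNReal.ofReal_one]
    exact (ENNReal.ofReal_lt_ofReal_iff one_pos).mpr hθ1
  have hdim : dimH B ≤ s := dimH_le_of_hausdorffMeasure_ne_top (ne_top_of_le_ne_top hfin hH)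
  calc dimH (badSet a j M ε) ≤ dimH B := (dimH_mono himg).trans (hlip.dimH_image_le B)
    _ ≤ s := hdim
    _ < 1 := by
      have : s < 1 := by rw [← NNReal.coe_lt_coe, hs, NNReal.coe_one]; linarith
      exact_mod_cast this

lemma measurableSet_badSet (a : ℕ → ℂ) (j : ℤ) (M : ℕ) (ε : ℝ) :
    MeasurableSet (badSet a j M ε) := by
  have : badSet a j M ε = ⋂ n : ℕ, ⋃ N ≥ n, {x | ε * N ≤ expSum a j M N x} := by
    ext x
    simp [badSet, frequently_atTop]
  rw [this]
  exact MeasurableSet.iInter fun n => MeasurableSet.iUnion fun N => MeasurableSet.iUnion fun _ =>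
    measurableSet_le measurable_const (continuous_expSum a j M N).measurable
lemma fiberMeasure_eq {ν : Measure (UnitAddCircle × UnitAddCircle)} [IsProbabilityMeasure ν]
    (y : UnitAddCircle) :
    fiberMeasure ν y = (ν.map Prod.swap).condKernel y := by
  have : IsFiniteMeasure (ν.map Prod.swap) := inferInstance
  unfold fiberMeasure
  exact dif_pos this

lemma fiber_null (ν : Measure (UnitAddCircle × UnitAddCircle)) [IsProbabilityMeasure ν]
    (τ : Measure UnitAddCircle) [IsProbabilityMeasure τ]
    (E : Set (UnitAddCircle × UnitAddCircle)) (hE : MeasurableSet E)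
    (h : ∀ᵐ y ∂(ν.map Prod.snd), (τ ∗ fiberMeasure ν y) {w | (w, y) ∈ E} = 0) :
    ∀ᵐ p : UnitAddCircle × (UnitAddCircle × UnitAddCircle) ∂(τ.prod ν),
      (p.1 + p.2.1, p.2.2) ∉ E := by
  have hmeas : Measurable (fun p : UnitAddCircle × (UnitAddCircle × UnitAddCircle) =>
      (p.1 + p.2.1, p.2.2)) := by fun_prop
  rw [ae_iff]
  simp only [not_not]
  have hE' : MeasurableSet {p : UnitAddCircle × (UnitAddCircle × UnitAddCircle) |
      (p.1 + p.2.1, p.2.2) ∈ E} := hmeas hE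
  rw [Measure.prod_apply_symm hE']
  set F : UnitAddCircle × UnitAddCircle → ℝ≥0∞ := fun q => τ ((fun z => (z, q)) ⁻¹'
    {p : UnitAddCircle × (UnitAddCircle × UnitAddCircle) | (p.1 + p.2.1, p.2.2) ∈ E}) with hF
  have hFm : Measurable F := measurable_measure_prodMk_right hE'
  have hFs : Measurable (fun p : UnitAddCircle × UnitAddCircle => F p.swap) :=
    hFm.comp measurable_swap
  have h1 : ∫⁻ q, F q ∂ν = ∫⁻ p, F p.swap ∂(ν.map Prod.swap) := by
    rw [lintegral_map hFs measurable_swap]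
    simp
  have hfst : (ν.map Prod.swap).fst = ν.map Prod.snd := by
    rw [Measure.fst, Measure.map_map measurable_fst measurable_swap]
    rfl
  rw [h1, ← (ν.map Prod.swap).disintegrate (ν.map Prod.swap).condKernel,
    Measure.lintegral_compProd hFs, hfst]
  rw [lintegral_eq_zero_iff]
  · filter_upwards [h] with y hy
    have hEy : MeasurableSet {w : UnitAddCircle | (w, y) ∈ E} :=
      (measurable_id.prodMk measurable_const) hE
    rw [fiberMeasure_eq, Measure.conv, Measure.map_apply measurable_add hEy,
      Measure.prod_apply_symm (measurable_add hEy)] at hy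
    exact hy
  · exact Measurable.lintegral_kernel_prod_right' hFs

lemma measure_zero_of_dim {μ : Measure UnitAddCircle} (hμ : measureDim μ = 1)
    {A : Set UnitAddCircle} (hA : MeasurableSet A) (hd : dimH A < 1) : μ A = 0 := by
  by_contra hne
  have : measureDim μ ≤ dimH A := by
    unfold measureDim
    exact iInf_le_of_le A (iInf_le_of_le hA (iInf_le_of_le (pos_iff_ne_zero.mpr hne) le_rfl))
  rw [hμ] at this
  exact absurd hd (not_lt.mpr this)

lemma map_iterate {m n : ℕ} {ν : Measure (UnitAddCircle × UnitAddCircle)}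
    (hinv : ν.map (fun q : UnitAddCircle × UnitAddCircle => (m • q.1, n • q.2)) = ν) (k : ℕ) :
    ν.map (fun q : UnitAddCircle × UnitAddCircle => (m ^ k • q.1, n ^ k • q.2)) = ν := by
  induction k with
  | zero => simp [Measure.map_id']
  | succ k ih =>
    have h1 : ∀ a b : ℕ, Measurable
        (fun q : UnitAddCircle × UnitAddCircle => (a • q.1, b • q.2)) := by
      intro a b
      exact ((continuous_nsmul a).measurable.comp measurable_fst).prodMk
        ((continuous_nsmul b).measurable.comp measurable_snd)
    have : (fun q : UnitAddCircle × UnitAddCircle => (m ^ (k + 1) • q.1, n ^ (k + 1) • q.2))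
      = (fun q : UnitAddCircle × UnitAddCircle => (m • q.1, n • q.2)) ∘
        (fun q : UnitAddCircle × UnitAddCircle => (m ^ k • q.1, n ^ k • q.2)) := by
      funext q
      simp only [Function.comp, ← mul_smul, pow_succ']
    rw [this, ← Measure.map_map (h1 _ _) (h1 _ _), ih, hinv]

lemma fourier_nsmul (j : ℤ) (k : ℕ) (x : UnitAddCircle) :
    (fourier j (k • x) : ℂ) = fourier (j * k) x := by
  rw [fourier_apply, fourier_apply, mul_smul, natCast_zsmul]

lemma fourier_uniqueness (P : Measure UnitAddCircle) [IsFiniteMeasure P]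
    (h : ∀ j : ℤ, j ≠ 0 → ∫ x, (fourier j x : ℂ) ∂P = 0) :
    P = P univ • (volume : Measure UnitAddCircle) := by
  have : IsFiniteMeasure (P univ • (volume : Measure UnitAddCircle)) :=
    Measure.smul_finite _ (measure_ne_top _ _)
  let A : StarSubalgebra ℂ (BoundedContinuousFunction UnitAddCircle ℂ) :=
    (fourierSubalgebra (T := 1)).comap (BoundedContinuousFunction.toContinuousMapStarₐ ℂ)
  refine ext_of_forall_mem_subalgebra_integral_eq_of_polish (𝕜 := ℂ) (A := A) ?_ ?_
  · intro x y hxy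
    obtain ⟨f, ⟨g, hg, rfl⟩, hne⟩ := fourierSubalgebra_separatesPoints (T := 1) hxy
    refine ⟨g, ⟨g, ?_, rfl⟩, hne⟩
    exact ⟨BoundedContinuousFunction.mkOfCompact g, hg, rfl⟩
  · intro g hg
    have hg' : (g.toContinuousMap : C(UnitAddCircle, ℂ)) ∈ Submodule.span ℂ (range (fourier (T := 1))) := by
      rw [← fourierSubalgebra_coe]
      exact hg
    have key : ∀ f ∈ Submodule.span ℂ (range (fourier (T := 1))),
        ∫ x, (f : UnitAddCircle → ℂ) x ∂P
          = ∫ x, (f : UnitAddCircle → ℂ) x ∂(P univ • (volume : Measure UnitAddCircle)) := by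
      intro f hf
      induction hf using Submodule.span_induction with
      | mem f hf =>
        obtain ⟨j, rfl⟩ := hf
        by_cases hj : j = 0
        · subst hj
          simp [measureReal_def, UnitAddCircle.measure_univ]
        · rw [h j hj, integral_smul_measure, integral_fourier_eq_zero hj, smul_zero]
      | zero => simp
      | add f g _ _ hf hg =>
        simp only [ContinuousMap.add_apply]
        rw [integral_add (integrable_circle f.continuous) (integrable_circle g.continuous),
          integral_add (integrable_circle f.continuous) (integrable_circle g.continuous), hf, hg]
      | smul c f _ hf =>
        simp only [ContinuousMap.smul_apply, smul_eq_mul]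
        rw [integral_const_mul, integral_const_mul, hf]
    exact key _ hg'

lemma fourier_fiber_zero
    (m n : ℕ) (hm : 2 ≤ m)
    (ν : Measure (UnitAddCircle × UnitAddCircle)) [IsProbabilityMeasure ν]
    (hinv : ν.map (fun q : UnitAddCircle × UnitAddCircle => (m • q.1, n • q.2)) = ν)
    (hfib : ∃ δ : ℝ≥0∞, 0 < δ ∧ ∀ τ : Measure UnitAddCircle, IsProbabilityMeasure τ →
      1 - δ ≤ measureDim τ → ∀ᵐ y ∂(ν.map Prod.snd), measureDim (τ ∗ fiberMeasure ν y) = 1)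
    (j : ℤ) (hj : j ≠ 0) (B : Set UnitAddCircle) (hB : MeasurableSet B) :
    ∫ p, (fourier j p.1 : ℂ) * B.indicator (fun _ => (1 : ℂ)) p.2 ∂ν = 0 := by
  set I := ∫ p, (fourier j p.1 : ℂ) * B.indicator (fun _ => (1 : ℂ)) p.2 ∂ν with hI
  by_contra hI0
  obtain ⟨δ, hδ, hfib⟩ := hfib
  obtain ⟨q, hq, τ, hτ, hτdim, hτhat⟩ := exists_tau m hm j δ hδ
  set M := m ^ q with hMdef
  have hM : 2 ≤ M := hm.trans (Nat.le_self_pow hq.ne' m)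
  set u : UnitAddCircle → ℂ := B.indicator (fun _ => (1 : ℂ)) with hu
  have hum : Measurable u := measurable_const.indicator hB
  have hu1 : ∀ y, ‖u y‖ ≤ 1 := by
    intro y
    by_cases hy : y ∈ B <;> simp [hu, hy]
  have hIle : ‖I‖ ≤ 1 := by
    have := norm_integral_le_of_norm_le_const (μ := ν) (C := 1)
      (f := fun p => (fourier j p.1 : ℂ) * u p.2) (Eventually.of_forall fun p => by
        rw [norm_mul, norm_fourier_apply, one_mul]; exact hu1 _)
    rwa [probReal_univ, mul_one] at this
  set th : ℕ → ℂ := fun k => ∫ x, (fourier (j * (M : ℤ) ^ k) x : ℂ) ∂τ with hth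
  have hth1 : ∀ k, ‖th k‖ ≤ 1 := by
    intro k
    have := norm_integral_le_of_norm_le_const (μ := τ) (C := 1)
      (f := fun x => (fourier (j * (M : ℤ) ^ k) x : ℂ)) (Eventually.of_forall fun p => by
        rw [norm_fourier_apply])
    rwa [probReal_univ, mul_one] at this
  set b : ℕ → ℂ := fun k => starRingEnd ℂ (th k * I) with hb
  have hb1 : ∀ k, ‖b k‖ ≤ 1 := by
    intro k
    simp only [hb, RCLike.norm_conj, norm_mul]
    exact mul_le_one₀ (hth1 k) (norm_nonneg _) hIle
  set a : UnitAddCircle → ℕ → ℂ := fun y k => b k * u ((n ^ q) ^ k • y) with ha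
  have ha1 : ∀ y k, ‖a y k‖ ≤ 1 := by
    intro y k
    simp only [ha, norm_mul]
    exact mul_le_one₀ (hb1 k) (norm_nonneg _) (hu1 _)
  set ε := ‖I‖ ^ 2 / 8 with hε
  have hIpos : 0 < ‖I‖ := norm_pos_iff.mpr hI0
  have hε0 : 0 < ε := by positivity
  have hε1 : ε ≤ 1 := by
    have : ‖I‖ ^ 2 ≤ 1 := pow_le_one₀ (norm_nonneg _) hIle
    linarith
  -- the exponential sums
  have hSm : ∀ N, Measurable fun w : UnitAddCircle × UnitAddCircle => expSum (a w.2) j M N w.1 := by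
    intro N
    unfold expSum
    refine Finset.measurable_sum _ fun k _ => Complex.measurable_re.comp ?_
    refine Measurable.mul ?_ ((fourier _).continuous.measurable.comp measurable_fst)
    exact measurable_const.mul (hum.comp ((continuous_nsmul _).measurable.comp measurable_snd))
  have hSb : ∀ N y x, |expSum (a y) j M N x| ≤ N := by
    intro N y x
    unfold expSum
    refine (Finset.abs_sum_le_sum_abs _ _).trans ?_
    calc _ ≤ ∑ k ∈ Finset.range N, (1 : ℝ) := by
          refine Finset.sum_le_sum fun k _ => (Complex.abs_re_le_norm _).trans ?_
          rw [norm_mul, norm_fourier_apply, mul_one]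
          exact ha1 y k
      _ = N := by simp
  set E : Set (UnitAddCircle × UnitAddCircle) := {w | w.1 ∈ badSet (a w.2) j M ε} with hE
  have hEm : MeasurableSet E := by
    have : E = ⋂ n : ℕ, ⋃ N ≥ n, {w | ε * N ≤ expSum (a w.2) j M N w.1} := by
      ext w
      simp [hE, badSet, frequently_atTop]
    rw [this]
    exact MeasurableSet.iInter fun n => MeasurableSet.iUnion fun N => MeasurableSet.iUnion fun _ =>
      measurableSet_le measurable_const (hSm N)
  have hnull := fiber_null ν τ E hEm (by
    filter_upwards [hfib τ hτ hτdim] with y hy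
    exact measure_zero_of_dim hy (measurableSet_badSet (a y) j M ε)
      (dimH_badSet (ha1 y) hj hM hε0 hε1))
  set S : ℕ → UnitAddCircle × (UnitAddCircle × UnitAddCircle) → ℝ :=
    fun N p => expSum (a p.2.2) j M N (p.1 + p.2.1) with hS
  have hSmeas : ∀ N, Measurable (S N) := by
    intro N
    exact (hSm N).comp (by fun_prop : Measurable (fun p : UnitAddCircle ×
      (UnitAddCircle × UnitAddCircle) => (p.1 + p.2.1, p.2.2)))
  set g : ℕ → UnitAddCircle × (UnitAddCircle × UnitAddCircle) → ℝ :=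
    fun N p => max (S N p / N - ε) 0 with hg
  have hgm : ∀ N, Measurable (g N) := fun N =>
    (((hSmeas N).div_const _).sub_const _).max measurable_const
  have hSN : ∀ N p, |S N p / N| ≤ 1 := by
    intro N p
    rw [abs_div, Nat.abs_cast]
    exact div_le_one_of_le₀ (hSb N _ _) (Nat.cast_nonneg _)
  have hgb : ∀ N p, ‖g N p‖ ≤ 1 := by
    intro N p
    rw [Real.norm_eq_abs, abs_of_nonneg (le_max_right _ _)]
    refine max_le ?_ zero_le_one
    linarith [(abs_le.mp (hSN N p)).2]
  have hlim : Tendsto (fun N => ∫ p, g N p ∂(τ.prod ν)) atTop (𝓝 0) := by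
    have := tendsto_integral_of_dominated_convergence (μ := τ.prod ν) (F := g) (f := fun _ => (0 : ℝ))
      (fun _ => (1 : ℝ)) (fun N => (hgm N).aestronglyMeasurable) (integrable_const _)
      (fun N => Eventually.of_forall (hgb N)) (by
        filter_upwards [hnull] with p hp
        have hp' : ∀ᶠ N : ℕ in atTop, ¬ (ε * N ≤ S N p) := not_frequently.mp hp
        refine tendsto_const_nhds.congr' ?_
        filter_upwards [hp', eventually_gt_atTop 0] with N hN hN0
        have hN0' : (0 : ℝ) < N := by exact_mod_cast hN0
        refine (max_eq_right ?_).symm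
        rw [sub_nonpos, div_le_iff₀ hN0']
        exact (not_le.mp hN).le)
    simpa using this
  have hIntg : ∀ k, ∫ p : UnitAddCircle × (UnitAddCircle × UnitAddCircle),
      (a p.2.2 k * fourier (j * (M : ℤ) ^ k) (p.1 + p.2.1)) ∂(τ.prod ν) = ((‖th k * I‖ ^ 2 : ℝ) : ℂ) := by
    intro k
    have e1 : ∀ p : UnitAddCircle × (UnitAddCircle × UnitAddCircle),
        a p.2.2 k * (fourier (j * (M : ℤ) ^ k) (p.1 + p.2.1) : ℂ)
        = (fourier (j * (M : ℤ) ^ k) p.1 : ℂ) *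
          (b k * (fourier (j * (M : ℤ) ^ k) p.2.1 * u ((n ^ q) ^ k • p.2.2))) := by
      intro p
      have : (fourier (j * (M : ℤ) ^ k) (p.1 + p.2.1) : ℂ)
          = fourier (j * (M : ℤ) ^ k) p.1 * fourier (j * (M : ℤ) ^ k) p.2.1 := by
        rw [fourier_apply, fourier_apply, fourier_apply, smul_add, AddCircle.toCircle_add]
        simp
      rw [this]
      simp only [ha]
      ring
    simp_rw [e1]
    rw [integral_prod_mul (fun x => (fourier (j * (M : ℤ) ^ k) x : ℂ))
      (fun w : UnitAddCircle × UnitAddCircle =>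
        b k * ((fourier (j * (M : ℤ) ^ k) w.1 : ℂ) * u ((n ^ q) ^ k • w.2))), integral_const_mul]
    have e2 : ∫ w : UnitAddCircle × UnitAddCircle,
        ((fourier (j * (M : ℤ) ^ k) w.1 : ℂ) * u ((n ^ q) ^ k • w.2)) ∂ν = I := by
      have hmap := map_iterate hinv (q * k)
      have hmm : Measurable (fun q' : UnitAddCircle × UnitAddCircle =>
          (m ^ (q * k) • q'.1, n ^ (q * k) • q'.2)) :=
        ((continuous_nsmul _).measurable.comp measurable_fst).prodMk
          ((continuous_nsmul _).measurable.comp measurable_snd)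
      have hfm : Measurable (fun p : UnitAddCircle × UnitAddCircle => (fourier j p.1 : ℂ) * u p.2) :=
        ((fourier _).continuous.measurable.comp measurable_fst).mul (hum.comp measurable_snd)
      rw [hI]
      conv_rhs => rw [← hmap]
      rw [integral_map hmm.aemeasurable hfm.aestronglyMeasurable]
      refine integral_congr_ae (Eventually.of_forall fun w => ?_)
      simp only [fourier_nsmul, hMdef]
      push_cast
      rw [pow_mul, pow_mul]
    rw [e2]
    change th k * (b k * I) = _
    rw [← Complex.normSq_eq_norm_sq, Complex.normSq_eq_conj_mul_self]
    simp only [hb]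
    ring
  have hterm_int : ∀ k, Integrable (fun p : UnitAddCircle × (UnitAddCircle × UnitAddCircle) =>
      (a p.2.2 k * fourier (j * (M : ℤ) ^ k) (p.1 + p.2.1) : ℂ)) (τ.prod ν) := by
    intro k
    refine Integrable.of_bound (C := 1) (Measurable.aestronglyMeasurable ?_)
      (Eventually.of_forall fun p => ?_)
    · refine Measurable.mul ?_ ((fourier _).continuous.measurable.comp (by fun_prop))
      exact measurable_const.mul (hum.comp ((continuous_nsmul _).measurable.comp
        (measurable_snd.comp measurable_snd)))
    · rw [norm_mul, norm_fourier_apply, mul_one]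
      exact ha1 _ _
  have hSint : ∀ N, ∫ p, S N p ∂(τ.prod ν) = ∑ k ∈ Finset.range N, ‖th k * I‖ ^ 2 := by
    intro N
    simp only [hS, expSum]
    have hre : ∀ k, Integrable (fun p : UnitAddCircle × (UnitAddCircle × UnitAddCircle) =>
        (a p.2.2 k * fourier (j * (M : ℤ) ^ k) (p.1 + p.2.1) : ℂ).re) (τ.prod ν) :=
      fun k => (hterm_int k).re
    rw [integral_finsetSum _ (fun k _ => hre k)]
    refine Finset.sum_congr rfl fun k _ => ?_
    have := integral_re (hterm_int k)
    rw [hIntg k] at this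
    exact this
  have hlow : ∀ N : ℕ, 0 < N → ‖I‖ ^ 2 / 4 - ε ≤ ∫ p, g N p ∂(τ.prod ν) := by
    intro N hN
    have hN' : (0 : ℝ) < N := by exact_mod_cast hN
    have h1 : ‖I‖ ^ 2 / 4 ≤ ∫ p, S N p / N ∂(τ.prod ν) := by
      rw [integral_div, hSint, le_div_iff₀ hN']
      calc ‖I‖ ^ 2 / 4 * N = ∑ k ∈ Finset.range N, ‖I‖ ^ 2 / 4 := by simp [mul_comm]
        _ ≤ _ := by
          refine Finset.sum_le_sum fun k _ => ?_
          rw [norm_mul, mul_pow]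
          have : (1 / 2 : ℝ) ≤ ‖th k‖ := hτhat k
          have h4 : (1 / 4 : ℝ) ≤ ‖th k‖ ^ 2 := by nlinarith
          nlinarith [sq_nonneg ‖I‖]
    have hi1 : Integrable (fun p => S N p / N) (τ.prod ν) :=
      Integrable.of_bound (C := 1) ((hSmeas N).div_const _).aestronglyMeasurable
        (Eventually.of_forall (hSN N))
    have h2 : ∫ p, (S N p / N - ε) ∂(τ.prod ν) ≤ ∫ p, g N p ∂(τ.prod ν) := by
      refine integral_mono (hi1.sub (integrable_const _)) ?_ (fun p => le_max_left _ _)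
      exact Integrable.of_bound (C := 1) (hgm N).aestronglyMeasurable (Eventually.of_forall (hgb N))
    rw [integral_sub hi1 (integrable_const _)] at h2
    simp only [integral_const, probReal_univ, one_smul] at h2
    linarith
  have hfinal : ‖I‖ ^ 2 / 4 - ε ≤ 0 :=
    ge_of_tendsto hlim (by filter_upwards [eventually_gt_atTop 0] with N hN using hlow N hN)
  have : 0 < ‖I‖ ^ 2 := by positivity
  linarith

/-- Claim 3.4 of the paper.  Let `m > n > 1` and let `ν` be a
`T_m × T_n`-invariant probability measure on `𝕋²` with `P₂ν = ρ` continuous and ergodic,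
`P₁ν = λ`, and such that for some `δ > 0`, convolving any measure `τ` of dimension
`≥ 1 − δ` with a.e. fiber of `ν` yields a measure of full dimension.  Then `ν = λ × ρ`. -/
theorem invariant_measure_rigidity
    (m n : ℕ) (hn : 1 < n) (hnm : n < m)
    (ν : Measure (UnitAddCircle × UnitAddCircle)) [IsProbabilityMeasure ν]
    (hinv : ν.map (fun q : UnitAddCircle × UnitAddCircle => (m • q.1, n • q.2)) = ν)
    (ρ : Measure UnitAddCircle) [IsProbabilityMeasure ρ]
    (hρ : ν.map Prod.snd = ρ)
    (hρcont : ∀ y : UnitAddCircle, ρ {y} = 0)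
    (hρerg : Ergodic (fun y : UnitAddCircle => n • y) ρ)
    (hleb : ν.map Prod.fst = (volume : Measure UnitAddCircle))
    (hfib : ∃ δ : ℝ≥0∞, 0 < δ ∧ ∀ τ : Measure UnitAddCircle, IsProbabilityMeasure τ →
      1 - δ ≤ measureDim τ → ∀ᵐ y ∂ρ, measureDim (τ ∗ fiberMeasure ν y) = 1) :
    ν = (volume : Measure UnitAddCircle).prod ρ := by
  subst hρ
  symm
  refine Measure.prod_eq fun A B hA hB => ?_
  set P : Measure UnitAddCircle := (ν.restrict (Prod.snd ⁻¹' B)).map Prod.fst with hP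
  have hBm : MeasurableSet (Prod.snd ⁻¹' B : Set (UnitAddCircle × UnitAddCircle)) :=
    measurable_snd hB
  have hPapp : ∀ A : Set UnitAddCircle, MeasurableSet A → P A = ν (A ×ˢ B) := by
    intro A hA
    rw [hP, Measure.map_apply measurable_fst hA, Measure.restrict_apply (measurable_fst hA)]
    rfl
  have hF := fourier_uniqueness P (fun j hj => by
    rw [hP, integral_map measurable_fst.aemeasurable (fourier j).continuous.aestronglyMeasurable,
      ← fourier_fiber_zero m n (by omega) ν hinv hfib j hj B hB, ← integral_indicator hBm]
    refine integral_congr_ae (Eventually.of_forall fun p => ?_)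
    by_cases hp : p.2 ∈ B
    · simp [indicator, hp]
    · simp [indicator, hp])
  have hU : P univ = ν.map Prod.snd B := by
    rw [hPapp _ MeasurableSet.univ, Measure.map_apply measurable_snd hB, univ_prod]
  rw [← hPapp A hA, hF, hU, Measure.smul_apply, smul_eq_mul, mul_comm]
end

section
/- Let m > n > 1 be integers and let θ be a Borel probability measure on 𝕋² invariant under T_m × T_n such that P₂θ = ρ is exact dimensional. If dim θ = 1 + dim ρ, then θ = λ × ρ. -/
open MeasureTheory Filter Set Topology
open scoped ENNReal

/-- A measure is exact dimensional if the local dimension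
`lim_{r → 0} log μ(B(x,r)) / log r` exists and is a.e. equal to a constant `d`. -/
def ExactDimensional {X : Type*} [MetricSpace X] [MeasurableSpace X]
    (μ : Measure X) : Prop :=
  ∃ d : ℝ, ∀ᵐ x ∂μ,
    Tendsto (fun r : ℝ => Real.log (μ (Metric.ball x r)).toReal / Real.log r)
      (𝓝[>] 0) (𝓝 d)

/-- The representative in `[0,1)`. -/
noncomputable def rep (x : UnitAddCircle) : ℝ := (AddCircle.equivIco 1 0 x : ℝ)

/-- Index of the cell at scale `1/L`. -/
noncomputable def dig (L : ℕ) (x : UnitAddCircle) : ℕ := ⌊(L : ℝ) * rep x⌋₊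

lemma rep_nonneg (x : UnitAddCircle) : 0 ≤ rep x := (AddCircle.equivIco 1 0 x).2.1

lemma rep_lt_one (x : UnitAddCircle) : rep x < 1 := by
  have := (AddCircle.equivIco (1 : ℝ) 0 x).2.2
  simpa [rep] using this

lemma coe_rep (x : UnitAddCircle) : ((rep x : ℝ) : UnitAddCircle) = x := AddCircle.coe_equivIco

lemma rep_coe (r : ℝ) : rep (r : UnitAddCircle) = Int.fract r := by
  simp [rep]

lemma rep_nsmul (M : ℕ) (x : UnitAddCircle) : rep (M • x) = Int.fract (M * rep x) := by
  rw [← rep_coe]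
  congr 1
  conv_lhs => rw [← coe_rep x]
  rw [← AddCircle.coe_nsmul, nsmul_eq_mul]

lemma measurable_rep : Measurable rep :=
  measurable_subtype_coe.comp (AddCircle.measurableEquivIco 1 0).measurable

lemma measurable_dig (L : ℕ) : Measurable (dig L) :=
  Nat.measurable_floor.comp (measurable_rep.const_mul _)

lemma dig_lt {L : ℕ} (hL : 0 < L) (x : UnitAddCircle) : dig L x < L := by
  unfold dig
  rw [Nat.floor_lt (by have := rep_nonneg x; positivity)]
  have : (0 : ℝ) < L := by exact_mod_cast hL
  nlinarith [rep_lt_one x]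

lemma dig_le (L : ℕ) (x : UnitAddCircle) : (dig L x : ℝ) ≤ L * rep x :=
  Nat.floor_le (by have := rep_nonneg x; positivity)

lemma lt_dig (L : ℕ) (x : UnitAddCircle) : L * rep x < dig L x + 1 := Nat.lt_floor_add_one _

lemma dig_div (N j l : ℕ) (hN : 0 < N) (h : j ≤ l) (y : UnitAddCircle) :
    dig (N ^ j) y = dig (N ^ l) y / N ^ (l - j) := by
  unfold dig
  rw [← Nat.floor_div_natCast]
  congr 1
  have : (N : ℝ) ≠ 0 := by positivity
  have h2 : N ^ l = N ^ j * N ^ (l - j) := by rw [← pow_add]; congr 1; omega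
  rw [h2]
  push_cast
  field_simp

lemma rep_eq_dig (M : ℕ) (x : UnitAddCircle) :
    (M : ℝ) * rep x = dig M x + rep (M • x) := by
  rw [rep_nsmul]
  unfold dig
  have h0 : 0 ≤ (M : ℝ) * rep x := by have := rep_nonneg x; positivity
  have := Int.floor_add_fract ((M : ℝ) * rep x)
  rw [← natCast_floor_eq_intCast_floor h0] at this
  exact this.symm

lemma dig_nsmul (N j : ℕ) (hN : 0 < N) (y : UnitAddCircle) :
    dig N (N ^ j • y) = dig (N ^ (j + 1)) y % N := by
  have h1 := rep_eq_dig (N ^ j) y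
  have h2 : dig (N ^ (j + 1)) y = N * dig (N ^ j) y + dig N (N ^ j • y) := by
    have h0 : 0 ≤ (N : ℝ) * rep (N ^ j • y) := by have := rep_nonneg (N ^ j • y); positivity
    conv_lhs => unfold dig
    have : ((N ^ (j + 1) : ℕ) : ℝ) * rep y
        = (N : ℝ) * rep (N ^ j • y) + ((N * dig (N ^ j) y : ℕ) : ℝ) := by
      push_cast at h1 ⊢
      rw [pow_succ]
      linear_combination (N : ℝ) * h1
    rw [this, Nat.floor_add_natCast h0, add_comm]
    rfl
  rw [h2, Nat.mul_add_mod, Nat.mod_eq_of_lt (dig_lt hN _)]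

lemma dig_nsmul_congr (N j l : ℕ) (hN : 0 < N) (h : j < l) (y y' : UnitAddCircle)
    (hy : dig (N ^ l) y = dig (N ^ l) y') : dig N (N ^ j • y) = dig N (N ^ j • y') := by
  rw [dig_nsmul _ _ hN, dig_nsmul _ _ hN, dig_div N (j + 1) l hN h, dig_div N (j + 1) l hN h, hy]

lemma dist_le_rep (x y : UnitAddCircle) : dist x y ≤ |rep x - rep y| := by
  conv_lhs => rw [← coe_rep x, ← coe_rep y]
  rw [dist_eq_norm, ← AddCircle.coe_sub, UnitAddCircle.norm_eq]
  simpa using round_le (rep x - rep y) 0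

lemma rep_close_of_dig (L : ℕ) (hL : 0 < L) (x y : UnitAddCircle) (h : dig L x = dig L y) :
    |rep x - rep y| ≤ 1 / L := by
  have h1 := dig_le L x
  have h2 := dig_le L y
  have h3 := lt_dig L x
  have h4 := lt_dig L y
  rw [h] at h1 h3
  have : (0 : ℝ) < L := by exact_mod_cast hL
  rw [abs_le, le_div_iff₀ this, neg_le_iff_add_nonneg, ← sub_nonneg]
  constructor
  · have : 0 ≤ (L : ℝ) * (rep x - rep y + 1 / L) := by
      field_simp; linarith
    rw [sub_zero]
    exact nonneg_of_mul_nonneg_right this ‹_›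
  · linarith

lemma rep_close_of_word (M J : ℕ) (hM : 0 < M) : ∀ (x x' : UnitAddCircle),
    (∀ j < J, dig M (M ^ j • x) = dig M (M ^ j • x')) → |rep x - rep x'| ≤ 1 / (M : ℝ) ^ J := by
  induction J with
  | zero =>
    intro x x' _
    rw [abs_le]
    constructor <;> simp <;> linarith [rep_nonneg x, rep_nonneg x', rep_lt_one x, rep_lt_one x']
  | succ J ih =>
    intro x x' h
    have h1 := ih (M • x) (M • x') (fun j hj => by
      have := h (j + 1) (by omega)
      simpa [pow_succ, mul_smul] using this)
    have h0 := h 0 (by omega)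
    simp only [pow_zero, one_smul] at h0
    have e1 := rep_eq_dig M x
    have e2 := rep_eq_dig M x'
    have hM' : (0 : ℝ) < M := by exact_mod_cast hM
    have : rep x - rep x' = (rep (M • x) - rep (M • x')) / M := by
      rw [eq_div_iff hM'.ne']
      rw [h0] at e1
      linarith
    rw [this, abs_div, abs_of_pos hM', pow_succ, ← div_div]
    gcongr

lemma dig_near (L : ℕ) (hL : 0 < L) (y z : UnitAddCircle) (h : dist y z < 1 / L) :
    (dig L y : ℤ) ∈ ({(dig L z : ℤ) - 1, (dig L z : ℤ), (dig L z : ℤ) + 1,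
      (dig L z : ℤ) + L - 1, (dig L z : ℤ) - L + 1, (dig L z : ℤ) + L, (dig L z : ℤ) - L,
      (dig L z : ℤ) + L + 1, (dig L z : ℤ) - L - 1} : Finset ℤ) := by
  have hL' : (0 : ℝ) < L := by exact_mod_cast hL
  rw [← coe_rep y, ← coe_rep z, dist_eq_norm, ← AddCircle.coe_sub, UnitAddCircle.norm_eq] at h
  rw [abs_lt, lt_div_iff₀ hL', neg_lt_iff_pos_add] at h
  obtain ⟨ha, hb⟩ := h
  set k := round (rep y - rep z) with hk
  have ha' : 0 < (L : ℝ) * (rep y - rep z - k + 1 / L) := by positivity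
  have hL1 : (L : ℝ) * (1 / L) = 1 := by field_simp
  have hr := abs_le.1 (abs_sub_round (rep y - rep z))
  rw [← hk] at hr
  have k1 : k < 2 := by
    have : (k : ℝ) < 2 := by linarith [hr.1, hr.2, rep_nonneg y, rep_nonneg z, rep_lt_one y, rep_lt_one z]
    exact_mod_cast this
  have k2 : -2 < k := by
    have : -2 < (k : ℝ) := by linarith [hr.1, hr.2, rep_nonneg y, rep_nonneg z, rep_lt_one y, rep_lt_one z]
    exact_mod_cast this
  have h1 := dig_le L y
  have h2 := dig_le L z
  have h3 := lt_dig L y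
  have h4 := lt_dig L z
  have q1 : (dig L y : ℤ) - dig L z - L * k < 2 := by
    have : (dig L y : ℝ) - dig L z - L * k < 2 := by linarith
    exact_mod_cast this
  have q2 : -2 < (dig L y : ℤ) - dig L z - L * k := by
    have : -2 < (dig L y : ℝ) - dig L z - L * k := by linarith
    exact_mod_cast this
  simp only [Finset.mem_insert, Finset.mem_singleton]
  have : k = -1 ∨ k = 0 ∨ k = 1 := by omega
  rcases this with e | e | e <;> rw [e] at q1 q2 <;> omega

lemma volume_cell (L : ℕ) (hL : 0 < L) (i : ℕ) (hi : i < L) :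
    (volume : Measure UnitAddCircle) (dig L ⁻¹' {i}) = ENNReal.ofReal (1 / L) := by
  have hL' : (0 : ℝ) < L := by exact_mod_cast hL
  have hm : MeasurableSet (dig L ⁻¹' {i}) := measurable_dig L (measurableSet_singleton i)
  rw [← (UnitAddCircle.measurePreserving_mk 0).measure_preimage hm.nullMeasurableSet,
    Measure.restrict_congr_set Ico_ae_eq_Ioc.symm,
    Measure.restrict_apply (AddCircle.measurable_mk' hm)]
  have : (QuotientAddGroup.mk : ℝ → UnitAddCircle) ⁻¹' (dig L ⁻¹' {i}) ∩ Ico 0 (0 + 1)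
      = Ico ((i : ℝ) / L) ((i + 1) / L) := by
    ext r
    simp only [mem_inter_iff, mem_preimage, mem_singleton_iff, mem_Ico, zero_add]
    have key : 0 ≤ r → r < 1 → (dig L (r : UnitAddCircle) = i ↔ (i : ℝ) ≤ L * r ∧ L * r < i + 1) := by
      intro h0 h1
      unfold dig
      rw [rep_coe, Int.fract_eq_self.2 ⟨h0, h1⟩, Nat.floor_eq_iff (by positivity)]
    rw [div_le_iff₀ hL', lt_div_iff₀ hL', mul_comm r]
    constructor
    · rintro ⟨h, h0, h1⟩
      exact (key h0 h1).1 h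
    · rintro ⟨h0, h1⟩
      have hi' : (i : ℝ) + 1 ≤ L := by exact_mod_cast hi
      have r0 : 0 ≤ r := by
        have : 0 ≤ (L : ℝ) * r := le_trans (Nat.cast_nonneg i) h0
        exact nonneg_of_mul_nonneg_right this hL'
      have r1 : r < 1 := by
        by_contra hr
        push Not at hr
        nlinarith
      exact ⟨(key r0 r1).2 ⟨h0, h1⟩, r0, r1⟩
  rw [this, Real.volume_Ico]
  congr 1
  ring

/-- Product cells. -/
def pcell (K L i j : ℕ) : Set (UnitAddCircle × UnitAddCircle) :=
  (dig K ⁻¹' {i}) ×ˢ (dig L ⁻¹' {j})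

lemma measurableSet_pcell (K L i j : ℕ) : MeasurableSet (pcell K L i j) :=
  (measurable_dig K (measurableSet_singleton i)).prod (measurable_dig L (measurableSet_singleton j))

lemma pcell_inter (m n : ℕ) (hm : 0 < m) (hn : 0 < n) (k k' i j i' j' : ℕ) (h : k ≤ k')
    (hne : (pcell (m ^ k) (n ^ k) i j ∩ pcell (m ^ k') (n ^ k') i' j').Nonempty) :
    pcell (m ^ k) (n ^ k) i j ∩ pcell (m ^ k') (n ^ k') i' j' = pcell (m ^ k') (n ^ k') i' j' := by
  rw [inter_eq_right]
  obtain ⟨z, ⟨h1, h2⟩, h3, h4⟩ := hne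
  simp only [mem_preimage, mem_singleton_iff] at h1 h2 h3 h4
  rintro w ⟨h5, h6⟩
  simp only [mem_preimage, mem_singleton_iff] at h5 h6
  constructor
  · simp only [mem_preimage, mem_singleton_iff]
    rw [← h1, dig_div m k k' hm h, dig_div m k k' hm h, h5, h3]
  · simp only [mem_preimage, mem_singleton_iff]
    rw [← h2, dig_div n k k' hn h, dig_div n k k' hn h, h6, h4]

lemma ext_cells (m n : ℕ) (hm : 1 < m) (hn : 1 < n)
    (μ ν : Measure (UnitAddCircle × UnitAddCircle)) [IsProbabilityMeasure μ]
    [IsProbabilityMeasure ν]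
    (h : ∀ k i j, i < m ^ (k + 1) → μ (pcell (m ^ (k + 1)) (n ^ (k + 1)) i j)
      = ν (pcell (m ^ (k + 1)) (n ^ (k + 1)) i j)) : μ = ν := by
  let C : Set (Set (UnitAddCircle × UnitAddCircle)) :=
    range (fun q : ℕ × ℕ × ℕ => pcell (m ^ (q.1 + 1)) (n ^ (q.1 + 1)) q.2.1 q.2.2)
  have hm0 : 0 < m := by omega
  have hn0 : 0 < n := by omega
  refine ext_of_generate_finite C ?_ ?_ ?_ (by simp)
  · apply le_antisymm
    · rw [BorelSpace.measurable_eq (α := UnitAddCircle × UnitAddCircle), borel]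
      apply MeasurableSpace.generateFrom_le
      intro U hU
      have hU : IsOpen U := hU
      have : U = ⋃ q ∈ {q : ℕ × ℕ × ℕ | pcell (m ^ (q.1 + 1)) (n ^ (q.1 + 1)) q.2.1 q.2.2 ⊆ U},
          pcell (m ^ (q.1 + 1)) (n ^ (q.1 + 1)) q.2.1 q.2.2 := by
        apply Subset.antisymm
        · intro z hz
          obtain ⟨ε, hε, hball⟩ := Metric.isOpen_iff.1 hU z hz
          have hlim : ∀ a : ℕ, 1 < a → ∀ᶠ k : ℕ in atTop, 1 / ((a ^ (k + 1) : ℕ) : ℝ) < ε := by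
            intro a ha
            have h1 : Tendsto (fun k : ℕ => ((1 : ℝ) / a) ^ (k + 1)) atTop (𝓝 0) := by
              apply (tendsto_add_atTop_iff_nat 1).2
              apply tendsto_pow_atTop_nhds_zero_of_lt_one (by positivity)
              rw [div_lt_one (by positivity)]
              exact_mod_cast ha
            filter_upwards [h1.eventually (gt_mem_nhds hε)] with k hk
            push_cast
            rwa [div_pow, one_pow] at hk
          obtain ⟨k, hk1, hk2⟩ := ((hlim m hm).and (hlim n hn)).exists
          simp only [mem_iUnion, exists_prop, mem_ofPred_eq]
          refine ⟨(k, dig (m ^ (k + 1)) z.1, dig (n ^ (k + 1)) z.2), ?_, ?_⟩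
          · rintro w ⟨h1, h2⟩
            apply hball
            rw [Metric.mem_ball, Prod.dist_eq]
            apply max_lt
            · exact lt_of_le_of_lt ((dist_le_rep _ _).trans
                (rep_close_of_dig _ (by positivity) _ _ h1)) hk1
            · exact lt_of_le_of_lt ((dist_le_rep _ _).trans
                (rep_close_of_dig _ (by positivity) _ _ h2)) hk2
          · exact ⟨rfl, rfl⟩
        · exact iUnion₂_subset (fun q hq => hq)
      rw [this]
      apply MeasurableSet.biUnion (to_countable _)
      intro q _
      exact MeasurableSpace.measurableSet_generateFrom ⟨q, rfl⟩
    · apply MeasurableSpace.generateFrom_le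
      rintro _ ⟨q, rfl⟩
      exact measurableSet_pcell _ _ _ _
  · rintro _ ⟨q, rfl⟩ _ ⟨q', rfl⟩ hne
    rcases le_total q.1 q'.1 with hle | hle
    · refine ⟨q', ?_⟩
      exact (pcell_inter m n hm0 hn0 _ _ _ _ _ _ (by omega) hne).symm
    · refine ⟨q, ?_⟩
      dsimp only at hne ⊢
      rw [inter_comm] at hne ⊢
      exact (pcell_inter m n hm0 hn0 _ _ _ _ _ _ (by omega) hne).symm
  · rintro _ ⟨q, rfl⟩
    by_cases hi : q.2.1 < m ^ (q.1 + 1)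
    · exact h _ _ _ hi
    · have : pcell (m ^ (q.1 + 1)) (n ^ (q.1 + 1)) q.2.1 q.2.2 = ∅ := by
        rw [eq_empty_iff_forall_notMem]
        rintro z ⟨h1, _⟩
        have h1 : dig _ _ = _ := h1
        have := dig_lt (L := m ^ (q.1 + 1)) (by positivity) z.1
        omega
      simp [this]

lemma card_cells (ρ : Measure UnitAddCircle) [IsProbabilityMeasure ρ] (L : ℕ) (hL : 0 < L)
    (b : ℝ) (S : Finset ℕ)
    (hS : ∀ c ∈ S, ∃ y, dig L y = c ∧ b ≤ (ρ (Metric.ball y (1 / L))).toReal) :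
    (S.card : ℝ) * b ≤ 9 := by
  classical
  choose! f hf using hS
  have h1 : ∑ c ∈ S, ρ (Metric.ball (f c) (1 / L)) ≤ 9 := by
    calc ∑ c ∈ S, ρ (Metric.ball (f c) (1 / L))
        = ∑ c ∈ S, ∫⁻ z, (Metric.ball (f c) (1 / L)).indicator 1 z ∂ρ := by
          refine Finset.sum_congr rfl fun c _ => ?_
          rw [lintegral_indicator_one Metric.isOpen_ball.measurableSet]
      _ = ∫⁻ z, ∑ c ∈ S, (Metric.ball (f c) (1 / L)).indicator 1 z ∂ρ := by
          rw [lintegral_finsetSum]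
          intro c _
          exact measurable_one.indicator Metric.isOpen_ball.measurableSet
      _ ≤ ∫⁻ _, 9 ∂ρ := by
          apply lintegral_mono
          intro z
          simp only [indicator_apply, Pi.one_apply, Finset.sum_boole]
          have : (S.filter (fun c => z ∈ Metric.ball (f c) (1 / L))).card ≤ 9 := by
            rw [← Finset.card_image_of_injective _ (Nat.cast_injective (R := ℤ))]
            refine (Finset.card_le_card (t := ({(dig L z : ℤ) - 1, (dig L z : ℤ), (dig L z : ℤ) + 1,
      (dig L z : ℤ) + L - 1, (dig L z : ℤ) - L + 1, (dig L z : ℤ) + L, (dig L z : ℤ) - L,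
      (dig L z : ℤ) + L + 1, (dig L z : ℤ) - L - 1} : Finset ℤ)) ?_).trans
              ((Finset.card_insert_le _ _).trans (Nat.succ_le_succ ((Finset.card_insert_le _ _).trans
              (Nat.succ_le_succ ((Finset.card_insert_le _ _).trans
              (Nat.succ_le_succ Finset.card_le_six))))))
            intro c hc
            rw [Finset.mem_image] at hc
            obtain ⟨a, ha, rfl⟩ := hc
            rw [Finset.mem_filter] at ha
            rw [← (hf a ha.1).1]
            apply dig_near L hL
            rw [dist_comm]
            exact ha.2
          exact_mod_cast this
      _ = 9 := by simp
  have h2 : ∑ c ∈ S, (ρ (Metric.ball (f c) (1 / L))).toReal ≤ 9 := by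
    rw [← ENNReal.toReal_sum (fun _ _ => measure_ne_top _ _)]
    exact ENNReal.toReal_le_of_le_ofReal (by norm_num) (by simpa using h1)
  calc (S.card : ℝ) * b = ∑ c ∈ S, b := by simp
    _ ≤ _ := Finset.sum_le_sum fun c hc => (hf c hc).2
    _ ≤ 9 := h2

lemma card_words (M J : ℕ) (f : Fin J → Fin M → ℝ) (hf : ∀ j i, 0 ≤ f j i)
    (hs : ∀ j, ∑ i, f j i = M) (τ : ℝ) (S : Finset (Fin J → Fin M))
    (hS : ∀ w ∈ S, τ ≤ ∏ j, f j (w j)) : (S.card : ℝ) * τ ≤ (M : ℝ) ^ J := by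
  classical
  calc (S.card : ℝ) * τ = ∑ w ∈ S, τ := by simp
    _ ≤ ∑ w ∈ S, ∏ j, f j (w j) := Finset.sum_le_sum hS
    _ ≤ ∑ w : Fin J → Fin M, ∏ j, f j (w j) := Finset.sum_le_univ_sum_of_nonneg
        (fun w => Finset.prod_nonneg fun j _ => hf j _)
    _ = ∏ j, ∑ i, f j i := by
        rw [Finset.prod_univ_sum]
        simp
    _ = (M : ℝ) ^ J := by simp [hs]

lemma cover_dim {X : Type*} [EMetricSpace X] [MeasurableSpace X] [BorelSpace X]
    (E : ℕ → Set X) (A : Set X) (hA : ∀ z ∈ A, ∃ᶠ J in atTop, z ∈ E J)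
    (s : NNReal) (r a : ℕ → ℝ≥0∞) (hr : Antitone r) (hr0 : Tendsto r atTop (𝓝 0))
    (ha : ∑' J, a J ≠ ∞)
    (hcov : ∀ J, ∃ C : Finset (Set X), E J ⊆ ⋃ c ∈ C, c ∧ (∀ c ∈ C, Metric.ediam c ≤ r J) ∧
      (C.card : ℝ≥0∞) * r J ^ (s : ℝ) ≤ a J) : dimH A ≤ s := by
  choose C hC1 hC2 hC3 using hcov
  apply dimH_le_of_hausdorffMeasure_ne_top
  have key := Measure.hausdorffMeasure_le_liminf_tsum (β := ℕ)
    (ι := fun K => Σ i : ℕ, {c : Set X // c ∈ C (i + K)}) (s : ℝ) A (l := atTop) r hr0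
    (fun K p => p.2.1)
    (Eventually.of_forall fun K p => (hC2 _ _ p.2.2).trans (hr (by omega)))
    (Eventually.of_forall fun K z hz => by
      obtain ⟨J, hJ, hzJ⟩ := (frequently_atTop.1 (hA z hz)) K
      have := hC1 J hzJ
      simp only [mem_iUnion, exists_prop] at this
      obtain ⟨c, hc, hzc⟩ := this
      rw [mem_iUnion]
      obtain ⟨i, rfl⟩ : ∃ i, J = i + K := ⟨J - K, by omega⟩
      exact ⟨⟨i, ⟨c, hc⟩⟩, hzc⟩)
  refine ne_top_of_le_ne_top ha (key.trans ?_)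
  refine (liminf_le_liminf (v := fun _ => ∑' J, a J) (Eventually.of_forall fun K => ?_)).trans ?_
  · rw [ENNReal.tsum_sigma (fun (i : ℕ) (c : {c : Set X // c ∈ C (i + K)}) =>
      Metric.ediam c.1 ^ (s : ℝ))]
    calc ∑' (i : ℕ) (c : {c : Set X // c ∈ C (i + K)}), Metric.ediam c.1 ^ (s : ℝ)
        ≤ ∑' i : ℕ, a (i + K) := by
          refine ENNReal.tsum_le_tsum fun i => le_trans ?_ (hC3 (i + K))
          rw [tsum_fintype]
          calc ∑ c : {c : Set X // c ∈ C (i + K)}, Metric.ediam c.1 ^ (s : ℝ)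
              ≤ ∑ c : {c : Set X // c ∈ C (i + K)}, r (i + K) ^ (s : ℝ) := by
                refine Finset.sum_le_sum fun c _ => ?_
                exact ENNReal.rpow_le_rpow (hC2 _ _ c.2) s.2
            _ = _ := by simp
      _ ≤ ∑' J, a J := ENNReal.tsum_comp_le_tsum_of_injective (add_left_injective K) a
  · simp

lemma local_upper {X : Type*} [MetricSpace X] [MeasurableSpace X] (ρ : Measure X)
    (x : X) (d s : ℝ) (hs : s < d)
    (h : Tendsto (fun r : ℝ => Real.log (ρ (Metric.ball x r)).toReal / Real.log r)
      (𝓝[>] 0) (𝓝 d)) :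
    ∀ᶠ r in 𝓝[>] (0 : ℝ), (ρ (Metric.ball x r)).toReal ≤ r ^ s := by
  have h1 : ∀ᶠ r in 𝓝[>] (0 : ℝ), r < 1 := nhdsWithin_le_nhds (gt_mem_nhds one_pos)
  filter_upwards [h.eventually (lt_mem_nhds hs), h1, self_mem_nhdsWithin] with r hr hr1 hr0
  have hr0 : 0 < r := hr0
  have hl : Real.log r < 0 := Real.log_neg hr0 hr1
  rw [lt_div_iff_of_neg hl] at hr
  rcases (ENNReal.toReal_nonneg (a := ρ (Metric.ball x r))).eq_or_lt with h0 | h0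
  · rw [← h0]; positivity
  · rw [← Real.log_le_log_iff h0 (by positivity), Real.log_rpow hr0]
    exact hr.le

lemma local_lower {X : Type*} [MetricSpace X] [MeasurableSpace X] (ρ : Measure X)
    [IsFiniteMeasure ρ]
    (x : X) (hx : x ∈ ρ.support) (d s : ℝ) (hs : d < s)
    (h : Tendsto (fun r : ℝ => Real.log (ρ (Metric.ball x r)).toReal / Real.log r)
      (𝓝[>] 0) (𝓝 d)) :
    ∀ᶠ r in 𝓝[>] (0 : ℝ), r ^ s ≤ (ρ (Metric.ball x r)).toReal := by
  have h1 : ∀ᶠ r in 𝓝[>] (0 : ℝ), r < 1 := nhdsWithin_le_nhds (gt_mem_nhds one_pos)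
  filter_upwards [h.eventually (gt_mem_nhds hs), h1, self_mem_nhdsWithin] with r hr hr1 hr0
  have hr0 : 0 < r := hr0
  have hl : Real.log r < 0 := Real.log_neg hr0 hr1
  rw [div_lt_iff_of_neg hl] at hr
  have h0 : 0 < (ρ (Metric.ball x r)).toReal :=
    ENNReal.toReal_pos ((Measure.mem_support_iff_forall x).1 hx _ (Metric.ball_mem_nhds x hr0)).ne'
      (measure_ne_top _ _)
  rw [← Real.log_le_log_iff (by positivity) h0, Real.log_rpow hr0]
  exact hr.le

lemma local_nonneg {X : Type*} [MetricSpace X] [MeasurableSpace X] (ρ : Measure X)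
    [IsProbabilityMeasure ρ] (x : X) (d : ℝ)
    (h : Tendsto (fun r : ℝ => Real.log (ρ (Metric.ball x r)).toReal / Real.log r)
      (𝓝[>] 0) (𝓝 d)) : 0 ≤ d := by
  have h1 : ∀ᶠ r in 𝓝[>] (0 : ℝ), r < 1 := nhdsWithin_le_nhds (gt_mem_nhds one_pos)
  refine ge_of_tendsto h ?_
  filter_upwards [h1, self_mem_nhdsWithin] with r hr1 hr0
  have hr0 : 0 < r := hr0
  apply div_nonneg_of_nonpos
  · apply Real.log_nonpos ENNReal.toReal_nonneg
    exact ENNReal.toReal_le_of_le_ofReal zero_le_one (by simpa using prob_le_one)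
  · exact (Real.log_neg hr0 hr1).le

lemma dim_lower {X : Type*} [MetricSpace X] [MeasurableSpace X] [BorelSpace X] (ρ : Measure X)
    [IsProbabilityMeasure ρ] (d : ℝ)
    (h : ∀ᵐ x ∂ρ, Tendsto (fun r : ℝ => Real.log (ρ (Metric.ball x r)).toReal / Real.log r)
      (𝓝[>] 0) (𝓝 d)) : ENNReal.ofReal d ≤ measureDim ρ := by
  unfold measureDim
  refine le_iInf fun A => le_iInf fun hA => le_iInf fun hpos => ?_
  refine le_of_forall_lt fun c hc => ?_
  obtain ⟨s, hcs, hsd⟩ := ENNReal.lt_iff_exists_nnreal_btwn.1 hc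
  refine lt_of_lt_of_le hcs ?_
  have hs0 : 0 < (s : ℝ) := by
    have : 0 < (s : ℝ≥0∞) := lt_of_le_of_lt (zero_le) hcs
    exact_mod_cast this
  have hsd' : (s : ℝ) < d := by
    rw [ENNReal.lt_ofReal_iff_toReal_lt ENNReal.coe_ne_top] at hsd
    simpa using hsd
  let G : ℕ → Set X := fun k =>
    {x | ∀ r : ℝ, 0 < r → r < 1 / ((k : ℝ) + 1) → (ρ (Metric.ball x r)).toReal ≤ r ^ (s : ℝ)}
  have hG : ∀ᵐ x ∂ρ, ∃ k, x ∈ G k := by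
    filter_upwards [h] with x hx
    have := local_upper ρ x d s hsd' hx
    rw [eventually_nhdsWithin_iff, Metric.eventually_nhds_iff] at this
    obtain ⟨ε, hε, hh⟩ := this
    obtain ⟨k, hk⟩ := exists_nat_one_div_lt hε
    refine ⟨k, fun r h0 h1 => hh ?_ h0⟩
    rw [Real.dist_eq, sub_zero, abs_of_pos h0]
    exact h1.trans hk
  obtain ⟨k, hk⟩ : ∃ k, 0 < ρ (A ∩ G k) := by
    by_contra hcon
    push Not at hcon
    have h0 : ρ (⋃ k, A ∩ G k) = 0 := by
      rw [measure_iUnion_null_iff]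
      intro k
      exact le_antisymm (hcon k) (zero_le)
    have : ρ A ≤ ρ (⋃ k, A ∩ G k) := by
      apply measure_mono_ae
      filter_upwards [hG] with x hx hxA
      obtain ⟨k, hk⟩ := hx
      exact mem_iUnion.2 ⟨k, hxA, hk⟩
    rw [h0] at this
    exact absurd hpos (not_lt.2 this)
  apply le_dimH_of_hausdorffMeasure_ne_zero
  have hle : ρ.restrict (G k) ≤ μH[(s : ℝ)] := by
    refine Measure.le_hausdorffMeasure (s : ℝ) _ (ENNReal.ofReal (1 / (2 * ((k : ℝ) + 1))))
      (by rw [ENNReal.ofReal_pos]; positivity) ?_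
    intro t ht
    have hcl : (ρ.restrict (G k)) t ≤ ρ (closure t ∩ G k) := by
      rw [← Measure.restrict_apply isClosed_closure.measurableSet]
      exact measure_mono subset_closure
    refine hcl.trans ?_
    rw [← Metric.ediam_closure] at ht ⊢
    rcases (closure t ∩ G k).eq_empty_or_nonempty with he | ⟨x, hxt, hxG⟩
    · simp [he]
    have hfin : Metric.ediam (closure t) ≠ ∞ := ne_top_of_le_ne_top ENNReal.ofReal_ne_top ht
    set D : ℝ := (Metric.ediam (closure t)).toReal with hD
    have hD0 : 0 ≤ D := ENNReal.toReal_nonneg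
    have hDe : Metric.ediam (closure t) = ENNReal.ofReal D := (ENNReal.ofReal_toReal hfin).symm
    have hDk : D < 1 / ((k : ℝ) + 1) := by
      have : D ≤ 1 / (2 * ((k : ℝ) + 1)) := ENNReal.toReal_le_of_le_ofReal (by positivity) ht
      refine lt_of_le_of_lt this ?_
      apply one_div_lt_one_div_of_lt <;> nlinarith [(Nat.cast_nonneg k : (0 : ℝ) ≤ k)]
    have hb : ∀ᶠ r in 𝓝[>] D, (ρ (closure t ∩ G k)).toReal ≤ r ^ (s : ℝ) := by
      filter_upwards [self_mem_nhdsWithin, nhdsWithin_le_nhds (gt_mem_nhds hDk)] with r h1 h2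
      have h1 : D < r := h1
      refine le_trans ?_ (hxG r (lt_of_le_of_lt hD0 h1) h2)
      apply ENNReal.toReal_mono (measure_ne_top _ _)
      apply measure_mono
      rintro y ⟨hy, _⟩
      rw [Metric.mem_ball]
      refine lt_of_le_of_lt ?_ h1
      have := Metric.edist_le_ediam_of_mem hy hxt
      rw [hDe, edist_dist, ENNReal.ofReal_le_ofReal_iff hD0] at this
      exact this
    have hcont : Tendsto (fun r : ℝ => r ^ (s : ℝ)) (𝓝[>] D) (𝓝 (D ^ (s : ℝ))) :=
      (Real.continuousAt_rpow_const D s (Or.inr hs0.le)).tendsto.mono_left nhdsWithin_le_nhds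
    have := ge_of_tendsto hcont hb
    rw [hDe, ENNReal.ofReal_rpow_of_nonneg hD0 hs0.le]
    exact (ENNReal.le_ofReal_iff_toReal_le (measure_ne_top _ _) (by positivity)).2 this
  have h2 := hle A
  rw [Measure.restrict_apply hA] at h2
  exact ne_of_gt (lt_of_lt_of_le hk h2)

/-- weight -/
noncomputable def wt (M i₀ j₀ : ℕ) (c : ℝ) (i j : ℕ) : ℝ :=
  1 + c * (((if i = i₀ then 1 else 0) - 1 / M) * (if j = j₀ then 1 else 0))

lemma wt_aux (M i₀ j₀ : ℕ) (hM : 0 < M) (i j : ℕ) :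
    |((if i = i₀ then (1 : ℝ) else 0) - 1 / M) * (if j = j₀ then 1 else 0)| ≤ 1 := by
  have h1 : (1 : ℝ) / M ≤ 1 := by
    rw [div_le_one (by exact_mod_cast hM)]; exact_mod_cast hM
  have h0 : (0 : ℝ) ≤ 1 / M := by positivity
  rw [abs_le]
  split_ifs <;> constructor <;> linarith

lemma wt_bounds (M i₀ j₀ : ℕ) (hM : 0 < M) (c : ℝ) (hc : |c| ≤ 1 / 2) (i j : ℕ) :
    1 / 2 ≤ wt M i₀ j₀ c i j ∧ wt M i₀ j₀ c i j ≤ 3 / 2 := by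
  have h := wt_aux M i₀ j₀ hM i j
  unfold wt
  set g := ((if i = i₀ then (1 : ℝ) else 0) - 1 / M) * (if j = j₀ then 1 else 0)
  have : |c * g| ≤ 1 / 2 := by
    rw [abs_mul]
    nlinarith [abs_nonneg c, abs_nonneg g]
  rw [abs_le] at this
  constructor <;> linarith

lemma wt_sum (M i₀ j₀ : ℕ) (hi : i₀ < M) (c : ℝ) (j : ℕ) :
    ∑ i : Fin M, wt M i₀ j₀ c i j = M := by
  have hM : (M : ℝ) ≠ 0 := by
    have : 0 < M := by omega
    positivity
  unfold wt
  rw [Finset.sum_add_distrib, ← Finset.mul_sum, ← Finset.sum_mul, Finset.sum_sub_distrib]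
  have : ∑ i : Fin M, (if (i : ℕ) = i₀ then (1 : ℝ) else 0) = 1 := by
    rw [Finset.sum_eq_single ⟨i₀, hi⟩]
    · simp
    · intro b _ hb
      rw [if_neg]
      intro h
      exact hb (Fin.ext h)
    · simp
  rw [this]
  simp [hM]

lemma log_ge (s : ℝ) (hs : |s| ≤ 1 / 2) : s - 2 * s ^ 2 ≤ Real.log (1 + s) := by
  rw [abs_le] at hs
  have h1 : 0 < 1 + s := by linarith
  refine le_trans ?_ (Real.one_sub_inv_le_log_of_pos h1)
  have : 1 - (1 + s)⁻¹ = s / (1 + s) := by field_simp; ring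
  rw [this, le_div_iff₀ h1]
  nlinarith [mul_nonneg (sq_nonneg s) (by linarith : 0 ≤ 1 + 2 * s)]

lemma measurable_wt {θ : Type*} [MeasurableSpace θ] (M i₀ j₀ : ℕ) (c : ℝ) (f g : θ → ℕ)
    (hf : Measurable f) (hg : Measurable g) : Measurable (fun z => Real.log (wt M i₀ j₀ c (f z) (g z))) :=
  (Measurable.of_discrete (f := fun p : ℕ × ℕ => Real.log (wt M i₀ j₀ c p.1 p.2))).comp (hf.prodMk hg)

lemma log_wt_abs (M i₀ j₀ : ℕ) (hM : 0 < M) (c : ℝ) (hc : |c| ≤ 1 / 2) (i j : ℕ) :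
    |Real.log (wt M i₀ j₀ c i j)| ≤ 1 := by
  obtain ⟨h1, h2⟩ := wt_bounds M i₀ j₀ hM c hc i j
  have hp : 0 < wt M i₀ j₀ c i j := by linarith
  rw [abs_le]
  constructor
  · refine le_trans ?_ (Real.one_sub_inv_le_log_of_pos hp)
    have : (wt M i₀ j₀ c i j)⁻¹ ≤ (1 / 2 : ℝ)⁻¹ := inv_anti₀ (by norm_num) h1
    norm_num at this
    linarith
  · have := Real.log_le_sub_one_of_pos hp
    linarith

lemma exists_c (M N : ℕ) (hM : 0 < M)
    (θ : Measure (UnitAddCircle × UnitAddCircle)) [IsProbabilityMeasure θ]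
    (ρ : Measure UnitAddCircle) (hρ : θ.map Prod.snd = ρ) (i₀ j₀ : ℕ)
    (hne : (θ (pcell M N i₀ j₀)).toReal ≠ 1 / M * (ρ (dig N ⁻¹' {j₀})).toReal) :
    ∃ c : ℝ, |c| ≤ 1 / 2 ∧
      0 < ∫ z, Real.log (wt M i₀ j₀ c (dig M z.1) (dig N z.2)) ∂θ := by
  classical
  let g : UnitAddCircle × UnitAddCircle → ℝ := fun z =>
    ((if dig M z.1 = i₀ then (1 : ℝ) else 0) - 1 / M) * (if dig N z.2 = j₀ then 1 else 0)
  have hd1 : Measurable (fun z : UnitAddCircle × UnitAddCircle => dig M z.1) :=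
    (measurable_dig M).comp measurable_fst
  have hd2 : Measurable (fun z : UnitAddCircle × UnitAddCircle => dig N z.2) :=
    (measurable_dig N).comp measurable_snd
  have hgm : Measurable g :=
    (Measurable.of_discrete (f := fun p : ℕ × ℕ =>
      ((if p.1 = i₀ then (1 : ℝ) else 0) - 1 / M) * (if p.2 = j₀ then 1 else 0))).comp
      (hd1.prodMk hd2)
  have hg1 : ∀ z, |g z| ≤ 1 := fun z => wt_aux M i₀ j₀ hM _ _
  have hgi : Integrable g θ := Integrable.of_bound hgm.aestronglyMeasurable 1
    (ae_of_all _ hg1)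
  have hm1 : MeasurableSet (pcell M N i₀ j₀) := measurableSet_pcell _ _ _ _
  have hm2 : MeasurableSet (Prod.snd ⁻¹' (dig N ⁻¹' {j₀}) : Set (UnitAddCircle × UnitAddCircle)) :=
    measurable_snd (measurable_dig N (measurableSet_singleton j₀))
  have hΔ : ∫ z, g z ∂θ = (θ (pcell M N i₀ j₀)).toReal - 1 / M * (ρ (dig N ⁻¹' {j₀})).toReal := by
    have e : g = fun z => (pcell M N i₀ j₀).indicator (1 : UnitAddCircle × UnitAddCircle → ℝ) z
        - 1 / M * (Prod.snd ⁻¹' (dig N ⁻¹' {j₀})).indicator (1 : UnitAddCircle × UnitAddCircle → ℝ) z := by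
      funext z
      simp only [g, indicator_apply, pcell, mem_prod, mem_preimage, mem_singleton_iff, Pi.one_apply]
      by_cases h1 : dig M z.1 = i₀ <;> by_cases h2 : dig N z.2 = j₀ <;> simp [h1, h2]
    rw [e, integral_sub, integral_const_mul, integral_indicator_one hm1, integral_indicator_one hm2,
      ← hρ, Measure.map_apply measurable_snd (measurable_dig N (measurableSet_singleton j₀))]
    · rfl
    · exact (integrable_const (1 : ℝ)).indicator hm1
    · exact ((integrable_const (1 : ℝ)).indicator hm2).const_mul _
  set Δ := ∫ z, g z ∂θ with hΔdef
  have hΔ0 : Δ ≠ 0 := by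
    rw [hΔ]; exact sub_ne_zero.2 hne
  have hΔ1 : |Δ| ≤ 1 := by
    have := norm_integral_le_of_norm_le_const (μ := θ) (f := g) (C := 1) (ae_of_all _ hg1)
    simpa using this
  have hc : |Δ / 4| ≤ 1 / 2 := by
    rw [abs_div, abs_of_pos (by norm_num : (0 : ℝ) < 4)]
    linarith
  refine ⟨Δ / 4, hc, ?_⟩
  have hlow : ∀ z, Δ / 4 * g z - 2 * (Δ / 4) ^ 2 ≤
      Real.log (wt M i₀ j₀ (Δ / 4) (dig M z.1) (dig N z.2)) := by
    intro z
    have hg := hg1 z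
    have hb : |Δ / 4 * g z| ≤ 1 / 2 := by
      rw [abs_mul]
      nlinarith [abs_nonneg (Δ / 4), abs_nonneg (g z)]
    refine le_trans ?_ (log_ge _ hb)
    have : g z ^ 2 ≤ 1 := by
      rw [← sq_abs]
      exact pow_le_one₀ (abs_nonneg _) hg
    nlinarith [mul_le_mul_of_nonneg_left this (sq_nonneg (Δ / 4))]
  have hInt : Integrable (fun z => Δ / 4 * g z - 2 * (Δ / 4) ^ 2) θ :=
    (hgi.const_mul _).sub (integrable_const _)
  have hInt2 : Integrable (fun z : UnitAddCircle × UnitAddCircle =>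
      Real.log (wt M i₀ j₀ (Δ / 4) (dig M z.1) (dig N z.2))) θ :=
    Integrable.of_bound (measurable_wt _ _ _ _ _ _ hd1 hd2).aestronglyMeasurable 1
      (ae_of_all _ fun z => log_wt_abs M i₀ j₀ hM _ hc _ _)
  refine lt_of_lt_of_le ?_ (integral_mono hInt hInt2 hlow)
  rw [integral_sub (hgi.const_mul _) (integrable_const _), integral_const_mul, ← hΔdef]
  simp only [integral_const, probReal_univ, smul_eq_mul, one_mul]
  have : 0 < Δ ^ 2 := by positivity
  nlinarith

/-- reverse Fatou for Birkhoff sums, without the ergodic theorem -/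
lemma birkhoff_pos {Ω : Type*} [MeasurableSpace Ω] (θ : Measure Ω) [IsProbabilityMeasure θ]
    (T : Ω → Ω) (hT : MeasurePreserving T θ θ) (φ : Ω → ℝ) (hφ : Measurable φ)
    (hb : ∀ z, |φ z| ≤ 1) (η : ℝ) (hη : η = ∫ z, φ z ∂θ) (hη0 : 0 < η) :
    ∃ A, MeasurableSet A ∧ 0 < θ A ∧
      ∀ z ∈ A, ∃ᶠ J : ℕ in atTop, J * (η / 2) ≤ ∑ j ∈ Finset.range J, φ (T^[j] z) := by
  let S : ℕ → Ω → ℝ := fun J z => ∑ j ∈ Finset.range J, φ (T^[j] z)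
  have hSm : ∀ J, Measurable (S J) := fun J =>
    Finset.measurable_sum _ fun j _ => hφ.comp (hT.measurable.iterate j)
  let F : ℕ → Set Ω := fun J => {z | J * (η / 2) ≤ S J z}
  have hFm : ∀ J, MeasurableSet (F J) := fun J => measurableSet_le measurable_const (hSm J)
  have hφi : Integrable φ θ := Integrable.of_bound hφ.aestronglyMeasurable 1 (ae_of_all _ hb)
  have hi : ∀ j, Integrable (fun z => φ (T^[j] z)) θ := fun j =>
    Integrable.of_bound (hφ.comp (hT.measurable.iterate j)).aestronglyMeasurable 1
      (ae_of_all _ fun z => hb _)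
  have hInt : ∀ J, ∫ z, S J z ∂θ = J * η := by
    intro J
    simp only [S]
    rw [integral_finsetSum _ (fun j _ => hi j)]
    have : ∀ j, ∫ z, φ (T^[j] z) ∂θ = η := by
      intro j
      have h1 := (hT.iterate j).map_eq
      have h2 := integral_map (μ := θ) (φ := T^[j]) (hT.iterate j).measurable.aemeasurable
        (f := φ) hφ.aestronglyMeasurable
      rw [h1] at h2
      rw [← h2, hη]
    simp [this]
  have hF : ∀ J, 1 ≤ J → η / 2 ≤ (θ (F J)).toReal := by
    intro J hJ
    have hJ' : (0 : ℝ) < J := by exact_mod_cast hJ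
    have hle : ∀ z, S J z ≤ J * (η / 2) + J * (F J).indicator (1 : Ω → ℝ) z := by
      intro z
      by_cases hz : z ∈ F J
      · rw [indicator_of_mem hz]
        have : S J z ≤ ∑ j ∈ Finset.range J, (1 : ℝ) :=
          Finset.sum_le_sum fun j _ => (abs_le.1 (hb _)).2
        simp at this
        simp only [Pi.one_apply]
        nlinarith
      · rw [indicator_of_notMem hz]
        have : ¬ (J * (η / 2) ≤ S J z) := hz
        linarith
    have h1 := integral_mono (μ := θ) (integrable_finsetSum _ (fun j _ => hi j))
      ((integrable_const (J * (η / 2))).add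
        (((integrable_const (1 : ℝ)).indicator (hFm J)).const_mul (J : ℝ))) hle
    rw [hInt J] at h1
    simp only [Pi.add_apply] at h1
    rw [integral_add (integrable_const _)
      (((integrable_const (1 : ℝ)).indicator (hFm J)).const_mul (J : ℝ)),
      integral_const_mul (J : ℝ) ((F J).indicator (fun _ => (1 : ℝ)))] at h1
    have h3 : ∫ z, (F J).indicator (fun _ => (1 : ℝ)) z ∂θ = (θ (F J)).toReal :=
      integral_indicator_one (hFm J)
    rw [h3] at h1
    simp only [integral_const, probReal_univ, smul_eq_mul, one_mul] at h1
    have h4 : (J : ℝ) * (η / 2) ≤ J * (θ (F J)).toReal := by linarith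
    exact le_of_mul_le_mul_left h4 hJ'
  let B : ℕ → Set Ω := fun K => ⋃ i, F (i + K + 1)
  have hBm : ∀ K, MeasurableSet (B K) := fun K => MeasurableSet.iUnion fun i => hFm _
  refine ⟨⋂ K, B K, MeasurableSet.iInter hBm, ?_, ?_⟩
  · have hanti : Antitone B := by
      intro K K' h
      apply iUnion_subset
      intro i
      obtain ⟨p, rfl⟩ := Nat.exists_eq_add_of_le h
      exact subset_iUnion_of_subset (i + p) (by
        have : i + p + K + 1 = i + (K + p) + 1 := by omega
        rw [this])
    have ht := tendsto_measure_iInter_atTop (μ := θ) (fun K => (hBm K).nullMeasurableSet) hanti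
      ⟨0, measure_ne_top _ _⟩
    have : ENNReal.ofReal (η / 2) ≤ θ (⋂ K, B K) := by
      refine ge_of_tendsto ht (Eventually.of_forall fun K => ?_)
      refine le_trans ?_ (measure_mono (subset_iUnion _ 0))
      rw [ENNReal.ofReal_le_iff_le_toReal (measure_ne_top _ _)]
      exact hF _ (by omega)
    refine lt_of_lt_of_le ?_ this
    rw [ENNReal.ofReal_pos]; positivity
  · intro z hz
    rw [frequently_atTop]
    intro K
    have := mem_iInter.1 hz K
    obtain ⟨i, hi⟩ := mem_iUnion.1 this
    exact ⟨i + K + 1, by omega, hi⟩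

lemma iterate_prod (M N : ℕ) (j : ℕ) (z : UnitAddCircle × UnitAddCircle) :
    (fun q : UnitAddCircle × UnitAddCircle => (M • q.1, N • q.2))^[j] z
      = (M ^ j • z.1, N ^ j • z.2) := by
  induction j with
  | zero => simp
  | succ j ih =>
    rw [Function.iterate_succ_apply', ih]
    simp only [pow_succ', mul_smul]

lemma measurable_T (M N : ℕ) :
    Measurable (fun q : UnitAddCircle × UnitAddCircle => (M • q.1, N • q.2)) := by
  apply Continuous.measurable
  fun_prop

/-- cells for the covering -/
def ccell (M L J : ℕ) (b : ℕ) (w : Fin J → Fin M) : Set (UnitAddCircle × UnitAddCircle) :=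
  {z | dig L z.2 = b ∧ ∀ j : Fin J, dig M (M ^ (j : ℕ) • z.1) = w j}

lemma ediam_ccell (M L J b : ℕ) (hM : 0 < M) (hL : M ^ J ≤ L) (w : Fin J → Fin M) :
    Metric.ediam (ccell M L J b w) ≤ ENNReal.ofReal (1 / (M : ℝ) ^ J) := by
  have hQ : (0 : ℝ) < (M : ℝ) ^ J := by positivity
  apply Metric.ediam_le
  rintro z ⟨h1, h2⟩ z' ⟨h1', h2'⟩
  rw [edist_dist]
  apply ENNReal.ofReal_le_ofReal
  rw [Prod.dist_eq]
  apply max_le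
  · refine (dist_le_rep _ _).trans (rep_close_of_word M J hM _ _ ?_)
    intro j hj
    rw [h2 ⟨j, hj⟩, h2' ⟨j, hj⟩]
  · have hL0 : 0 < L := lt_of_lt_of_le (by positivity) hL
    refine (dist_le_rep _ _).trans ((rep_close_of_dig L hL0 _ _ (h1.trans h1'.symm)).trans ?_)
    apply one_div_le_one_div_of_le hQ
    exact_mod_cast hL

lemma cover_count (M N J l : ℕ) (hN : 1 < N) (hM : 0 < M) (hJl : J ≤ l) (hl : M ^ J ≤ N ^ l)
    (ρ : Measure UnitAddCircle) [IsProbabilityMeasure ρ] (i₀ j₀ : ℕ) (hi₀ : i₀ < M)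
    (c : ℝ) (hc : |c| ≤ 1 / 2) (b τ : ℝ) (hb : 0 < b) (hτ : 0 < τ)
    (E : Set (UnitAddCircle × UnitAddCircle))
    (hE1 : ∀ z ∈ E, b ≤ (ρ (Metric.ball z.2 (1 / (N ^ l : ℕ)))).toReal)
    (hE2 : ∀ z ∈ E, τ ≤ ∏ j : Fin J, wt M i₀ j₀ c (dig M (M ^ (j : ℕ) • z.1))
      (dig N (N ^ (j : ℕ) • z.2))) :
    ∃ C : Finset (Set (UnitAddCircle × UnitAddCircle)), E ⊆ ⋃ c ∈ C, c ∧
      (∀ c ∈ C, Metric.ediam c ≤ ENNReal.ofReal (1 / (M : ℝ) ^ J)) ∧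
      (C.card : ℝ) ≤ (9 / b) * ((M : ℝ) ^ J / τ) := by
  classical
  have hN0 : 0 < N := by omega
  have hL0 : 0 < N ^ l := by positivity
  let Sg : Finset ℕ := (Finset.range (N ^ l)).filter
    (fun a => ∃ y, dig (N ^ l) y = a ∧ b ≤ (ρ (Metric.ball y (1 / (N ^ l : ℕ)))).toReal)
  let W : ℕ → Finset (Fin J → Fin M) := fun a => Finset.univ.filter
    (fun w => ∃ y, dig (N ^ l) y = a ∧
      τ ≤ ∏ j : Fin J, wt M i₀ j₀ c (w j) (dig N (N ^ (j : ℕ) • y)))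
  have hSg : (Sg.card : ℝ) ≤ 9 / b := by
    rw [le_div_iff₀ hb]
    exact card_cells ρ (N ^ l) hL0 b Sg (fun a ha => (Finset.mem_filter.1 ha).2)
  have hW : ∀ a, ((W a).card : ℝ) ≤ (M : ℝ) ^ J / τ := by
    intro a
    rw [le_div_iff₀ hτ]
    rcases (W a).eq_empty_or_nonempty with he | ⟨w0, hw0⟩
    · rw [he]; simp
    obtain ⟨y0, hy0, -⟩ := (Finset.mem_filter.1 hw0).2
    refine card_words M J (fun j i => wt M i₀ j₀ c i (dig N (N ^ (j : ℕ) • y0))) ?_ ?_ τ (W a) ?_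
    · intro j i
      have := (wt_bounds M i₀ j₀ hM c hc i (dig N (N ^ (j : ℕ) • y0))).1
      linarith
    · intro j
      exact wt_sum M i₀ j₀ hi₀ c _
    · intro w hw
      obtain ⟨y, hy, h⟩ := (Finset.mem_filter.1 hw).2
      refine h.trans (le_of_eq ?_)
      refine Finset.prod_congr rfl fun j _ => ?_
      rw [dig_nsmul_congr N j l hN0 (lt_of_lt_of_le j.2 hJl) y y0 (hy.trans hy0.symm)]
  let P : Finset (Σ _ : ℕ, (Fin J → Fin M)) := Sg.sigma W
  refine ⟨P.image (fun p => ccell M (N ^ l) J p.1 p.2), ?_, ?_, ?_⟩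
  · intro z hz
    simp only [mem_iUnion, exists_prop, Finset.mem_image]
    refine ⟨_, ⟨⟨dig (N ^ l) z.2, fun j => ⟨dig M (M ^ (j : ℕ) • z.1), dig_lt hM _⟩⟩, ?_, rfl⟩, ?_⟩
    · rw [Finset.mem_sigma]
      refine ⟨Finset.mem_filter.2 ⟨Finset.mem_range.2 (dig_lt hL0 _), z.2, rfl, hE1 z hz⟩,
        Finset.mem_filter.2 ⟨Finset.mem_univ _, z.2, rfl, hE2 z hz⟩⟩
    · exact ⟨rfl, fun j => rfl⟩
  · intro s hs
    rw [Finset.mem_image] at hs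
    obtain ⟨p, -, rfl⟩ := hs
    exact ediam_ccell M (N ^ l) J p.1 hM hl p.2
  · calc ((P.image (fun p => ccell M (N ^ l) J p.1 p.2)).card : ℝ) ≤ P.card := by
          exact_mod_cast Finset.card_image_le
      _ = ∑ a ∈ Sg, ((W a).card : ℝ) := by
          simp only [P]
          rw [Finset.card_sigma]
          push_cast
          rfl
      _ ≤ ∑ a ∈ Sg, (M : ℝ) ^ J / τ := Finset.sum_le_sum fun a _ => hW a
      _ = Sg.card * ((M : ℝ) ^ J / τ) := by simp
      _ ≤ _ := by gcongr

lemma core (M N : ℕ) (hN : 1 < N) (hNM : N < M)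
    (θ : Measure (UnitAddCircle × UnitAddCircle)) [IsProbabilityMeasure θ]
    (hinv : θ.map (fun q : UnitAddCircle × UnitAddCircle => (M • q.1, N • q.2)) = θ)
    (ρ : Measure UnitAddCircle) [IsProbabilityMeasure ρ] (hρ : θ.map Prod.snd = ρ) (d : ℝ)
    (hd : ∀ᵐ x ∂ρ, Tendsto (fun r : ℝ => Real.log (ρ (Metric.ball x r)).toReal / Real.log r)
      (𝓝[>] 0) (𝓝 d))
    (i₀ j₀ : ℕ) (hi₀ : i₀ < M)
    (hne : (θ (pcell M N i₀ j₀)).toReal ≠ 1 / M * (ρ (dig N ⁻¹' {j₀})).toReal) :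
    ∃ A, MeasurableSet A ∧ 0 < θ A ∧ dimH A < 1 + ENNReal.ofReal d := by
  have hM : 0 < M := by omega
  have hM1 : (1 : ℝ) < M := by exact_mod_cast hN.trans hNM
  have hM0 : (0 : ℝ) < M := by positivity
  have hN0 : (0 : ℝ) < N := by positivity
  have hlogM : 0 < Real.log M := Real.log_pos hM1
  obtain ⟨c, hc, hη0⟩ := exists_c M N hM θ ρ hρ i₀ j₀ hne
  set η := ∫ z, Real.log (wt M i₀ j₀ c (dig M z.1) (dig N z.2)) ∂θ with hη
  obtain ⟨A0, hA0m, hA0pos, hA0⟩ := birkhoff_pos θ _ ⟨measurable_T M N, hinv⟩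
    (fun z => Real.log (wt M i₀ j₀ c (dig M z.1) (dig N z.2)))
    (measurable_wt _ _ _ _ _ _ ((measurable_dig M).comp measurable_fst)
      ((measurable_dig N).comp measurable_snd))
    (fun z => log_wt_abs M i₀ j₀ hM c hc _ _) η hη hη0
  have hd0 : 0 ≤ d := by
    obtain ⟨x, hx⟩ := hd.exists
    exact local_nonneg ρ x d hx
  obtain ⟨κ, hκ0, hκ1, hκη⟩ : ∃ κ : ℝ, 0 < κ ∧ κ ≤ 1 ∧ κ * Real.log M ≤ η / 2 := by
    refine ⟨min 1 (η / 2 / Real.log M), by positivity, min_le_left _ _, ?_⟩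
    rw [← le_div_iff₀ hlogM]
    exact min_le_right _ _
  let l : ℕ → ℕ := fun J => Nat.clog N (M ^ J)
  have hl1 : ∀ J, M ^ J ≤ N ^ l J := fun J => Nat.le_pow_clog hN _
  have hl2 : ∀ J, N ^ l J ≤ N * M ^ J := by
    intro J
    rcases Nat.lt_or_ge 1 (M ^ J) with h | h
    · have h1 := (Nat.pow_pred_clog_lt_self hN h).le
      have h2 : 0 < l J := Nat.clog_pos hN h
      calc N ^ l J = N * N ^ (l J).pred := by
            rw [← pow_succ']
            exact congrArg (fun t => N ^ t) (Nat.succ_pred_eq_of_pos h2).symm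
        _ ≤ N * M ^ J := Nat.mul_le_mul_left _ h1
    · have : l J = 0 := Nat.clog_of_right_le_one h N
      rw [this, pow_zero]
      have : 0 < N * M ^ J := by positivity
      omega
  have hJl : ∀ J, J ≤ l J := by
    intro J
    have : N ^ J ≤ N ^ l J := (Nat.pow_le_pow_left hNM.le J).trans (hl1 J)
    exact (Nat.pow_le_pow_iff_right hN).1 this
  let r : ℕ → ℝ := fun J => 1 / ((N ^ l J : ℕ) : ℝ)
  have hr0 : ∀ J, 0 < r J := fun J => by
    have : 0 < N ^ l J := by positivity
    simp only [r]
    positivity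
  have hpow0 : Tendsto (fun J : ℕ => 1 / (M : ℝ) ^ J) atTop (𝓝 0) := by
    have := tendsto_pow_atTop_nhds_zero_of_lt_one (r := 1 / (M : ℝ)) (by positivity)
      (by rw [div_lt_one hM0]; exact hM1)
    simpa using this
  have hrt : Tendsto r atTop (𝓝[>] 0) := by
    rw [tendsto_nhdsWithin_iff]
    refine ⟨squeeze_zero (fun J => (hr0 J).le) (fun J => ?_) hpow0, Eventually.of_forall hr0⟩
    apply one_div_le_one_div_of_le (by positivity)
    exact_mod_cast hl1 J
  let good : UnitAddCircle × UnitAddCircle → Prop := fun z =>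
    ∀ᶠ J in atTop, r J ^ (d + κ / 3) ≤ (ρ (Metric.ball z.2 (r J))).toReal
  have hgood : ∀ᵐ z ∂θ, good z := by
    have : ∀ᵐ y ∂ρ, ∀ᶠ J in atTop, r J ^ (d + κ / 3) ≤ (ρ (Metric.ball y (r J))).toReal := by
      filter_upwards [hd, Measure.support_mem_ae] with y hy hys
      exact hrt.eventually (local_lower ρ y hys d (d + κ / 3) (by linarith) hy)
    rw [← hρ] at this
    rw [hρ] at this
    have h2 : ∀ᵐ y ∂(θ.map Prod.snd), ∀ᶠ J in atTop,
        r J ^ (d + κ / 3) ≤ (ρ (Metric.ball y (r J))).toReal := by rw [hρ]; exact this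
    exact ae_of_ae_map measurable_snd.aemeasurable h2
  let B := toMeasurable θ {z | ¬ good z}
  have hB : θ B = 0 := by
    rw [measure_toMeasurable]
    exact hgood
  let E : ℕ → Set (UnitAddCircle × UnitAddCircle) := fun J =>
    {z | J * (η / 2) ≤ ∑ j ∈ Finset.range J, Real.log (wt M i₀ j₀ c (dig M (M ^ j • z.1))
        (dig N (N ^ j • z.2))) ∧ r J ^ (d + κ / 3) ≤ (ρ (Metric.ball z.2 (r J))).toReal}
  refine ⟨A0 \ B, hA0m.diff (measurableSet_toMeasurable _ _), ?_, ?_⟩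
  · rwa [measure_sdiff_null hB]
  have hs0 : 0 ≤ d + 1 - κ / 3 := by linarith
  obtain ⟨s, hs⟩ : ∃ s : NNReal, (s : ℝ) = d + 1 - κ / 3 := ⟨⟨_, hs0⟩, rfl⟩
  have hdim : dimH (A0 \ B) ≤ (s : ℝ≥0∞) := by
    refine cover_dim E (A0 \ B) ?_ _ (fun J => ENNReal.ofReal (1 / (M : ℝ) ^ J))
      (fun J => ENNReal.ofReal (9 * (N : ℝ) ^ (d + κ / 3) * ((M : ℝ) ^ (- (κ / 3))) ^ J)) ?_ ?_ ?_ ?_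
    · rintro z ⟨hz1, hz2⟩
      have hg : good z := by
        by_contra hcon
        exact hz2 (subset_toMeasurable _ _ hcon)
      refine ((hA0 z hz1).and_eventually hg).mono ?_
      rintro J ⟨h1, h2⟩
      refine ⟨?_, h2⟩
      simpa only [iterate_prod] using h1
    · intro J J' h
      apply ENNReal.ofReal_le_ofReal
      apply one_div_le_one_div_of_le (by positivity)
      exact pow_le_pow_right₀ hM1.le h
    · rw [← ENNReal.ofReal_zero]
      exact ENNReal.tendsto_ofReal hpow0
    · apply Summable.tsum_ofReal_ne_top
      apply Summable.mul_left
      apply summable_geometric_of_lt_one (by positivity)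
      exact Real.rpow_lt_one_of_one_lt_of_neg hM1 (by linarith)
    · intro J
      obtain ⟨C, hC1, hC2, hC3⟩ := cover_count M N J (l J) hN hM (hJl J) (hl1 J) ρ i₀ j₀ hi₀ c hc
        (r J ^ (d + κ / 3)) (Real.exp (J * (η / 2))) (Real.rpow_pos_of_pos (hr0 J) _)
        (Real.exp_pos _) (E J) (fun z hz => hz.2) (by
          intro z hz
          have h1 := Real.exp_le_exp.2 hz.1
          rw [Real.exp_sum, Finset.prod_range] at h1
          refine h1.trans (le_of_eq ?_)
          refine Finset.prod_congr rfl fun j _ => ?_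
          rw [Real.exp_log]
          have := (wt_bounds M i₀ j₀ hM c hc (dig M (M ^ (j : ℕ) • z.1))
            (dig N (N ^ (j : ℕ) • z.2))).1
          linarith)
      refine ⟨C, hC1, hC2, ?_⟩
      set Q : ℝ := (M : ℝ) ^ J with hQ
      have hQ0 : 0 < Q := by positivity
      have e1 : 9 / r J ^ (d + κ / 3) ≤ 9 * (N : ℝ) ^ (d + κ / 3) * Q ^ (d + κ / 3) := by
        have hNl : (0 : ℝ) < ((N ^ l J : ℕ) : ℝ) := by
          have : 0 < N ^ l J := by positivity
          exact_mod_cast this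
        simp only [r]
        rw [one_div, Real.inv_rpow hNl.le, div_inv_eq_mul, mul_assoc,
          ← Real.mul_rpow hN0.le hQ0.le]
        have : ((N ^ l J : ℕ) : ℝ) ≤ N * Q := by
          rw [hQ]
          exact_mod_cast hl2 J
        gcongr
      have e2 : Q / Real.exp (J * (η / 2)) ≤ Q * Q ^ (-κ) := by
        rw [div_eq_mul_inv, Real.rpow_neg hQ0.le]
        gcongr
        rw [Real.rpow_def_of_pos hQ0, hQ, Real.log_pow]
        apply Real.exp_le_exp.2
        have : (0 : ℝ) ≤ J := Nat.cast_nonneg J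
        nlinarith
      have e3 : (C.card : ℝ) * (1 / Q) ^ (d + 1 - κ / 3)
          ≤ 9 * (N : ℝ) ^ (d + κ / 3) * ((M : ℝ) ^ (- (κ / 3))) ^ J := by
        have e4 : (C.card : ℝ) ≤ 9 * (N : ℝ) ^ (d + κ / 3) * Q ^ (d + κ / 3) * (Q * Q ^ (-κ)) :=
          hC3.trans (mul_le_mul e1 e2 (by positivity) (by positivity))
        have e5 : ((M : ℝ) ^ (- (κ / 3))) ^ J = Q ^ (- (κ / 3)) := by
          rw [hQ, ← Real.rpow_natCast, ← Real.rpow_natCast, ← Real.rpow_mul hM0.le,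
            ← Real.rpow_mul hM0.le, mul_comm]
        have e6 : (1 / Q) ^ (d + 1 - κ / 3) = Q ^ (-(d + 1 - κ / 3)) := by
          rw [one_div, Real.inv_rpow hQ0.le, Real.rpow_neg hQ0.le]
        have e7 : Q ^ (d + κ / 3) * (Q * Q ^ (-κ)) * Q ^ (-(d + 1 - κ / 3)) = Q ^ (- (κ / 3)) := by
          have : Q * Q ^ (-κ) = Q ^ (1 - κ) := by
            rw [sub_eq_add_neg, Real.rpow_add hQ0, Real.rpow_one]
          rw [this, ← Real.rpow_add hQ0, ← Real.rpow_add hQ0]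
          congr 1
          ring
        rw [e5, ← e7, e6]
        calc (C.card : ℝ) * Q ^ (-(d + 1 - κ / 3))
            ≤ 9 * (N : ℝ) ^ (d + κ / 3) * Q ^ (d + κ / 3) * (Q * Q ^ (-κ))
              * Q ^ (-(d + 1 - κ / 3)) := by gcongr
          _ = _ := by ring
      rw [hs, ENNReal.ofReal_rpow_of_pos (by positivity), ← ENNReal.ofReal_natCast,
        ← ENNReal.ofReal_mul (by positivity)]
      exact ENNReal.ofReal_le_ofReal e3
  refine lt_of_le_of_lt hdim ?_
  rw [← ENNReal.ofReal_one, ← ENNReal.ofReal_add zero_le_one hd0, ENNReal.coe_nnreal_eq]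
  rw [ENNReal.ofReal_lt_ofReal_iff (by linarith)]
  rw [hs]
  linarith

/-- Claim 3.2 of the paper.  Let `m > n > 1` and let `θ` be a
`T_m × T_n`-invariant probability measure on `𝕋²` such that `ρ = P₂θ` is exact
dimensional.  If `dim θ = 1 + dim ρ`, then `θ = λ × ρ`. -/
theorem full_dimension_implies_product
    (m n : ℕ) (hn : 1 < n) (hnm : n < m)
    (θ : Measure (UnitAddCircle × UnitAddCircle)) [IsProbabilityMeasure θ]
    (hinv : θ.map (fun q : UnitAddCircle × UnitAddCircle => (m • q.1, n • q.2)) = θ)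
    (ρ : Measure UnitAddCircle) (hρ : θ.map Prod.snd = ρ)
    (hρexact : ExactDimensional ρ)
    (hdim : measureDim θ = 1 + measureDim ρ) :
    θ = (volume : Measure UnitAddCircle).prod ρ := by
  have : IsProbabilityMeasure ρ := by
    rw [← hρ]
    exact Measure.isProbabilityMeasure_map measurable_snd.aemeasurable
  have : IsProbabilityMeasure (volume : Measure UnitAddCircle) := ⟨by simp⟩
  obtain ⟨d, hd⟩ := hρexact
  have hm0 : 0 < m := by omega
  apply ext_cells m n (hn.trans hnm) hn
  intro k i j hi
  by_contra hne
  have hMP : MeasurePreserving (fun q : UnitAddCircle × UnitAddCircle => (m • q.1, n • q.2)) θ θ :=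
    ⟨measurable_T m n, hinv⟩
  have hinv' : θ.map (fun q : UnitAddCircle × UnitAddCircle =>
      (m ^ (k + 1) • q.1, n ^ (k + 1) • q.2)) = θ := by
    have := (hMP.iterate (k + 1)).map_eq
    have e : (fun q : UnitAddCircle × UnitAddCircle => (m • q.1, n • q.2))^[k + 1]
        = fun q => (m ^ (k + 1) • q.1, n ^ (k + 1) • q.2) := by
      funext z
      exact iterate_prod m n (k + 1) z
    rwa [e] at this
  obtain ⟨A, hAm, hApos, hAdim⟩ := core (m ^ (k + 1)) (n ^ (k + 1))
    (Nat.one_lt_pow (by omega) hn) (Nat.pow_lt_pow_left hnm (by omega)) θ hinv' ρ hρ d hd i j hi (by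
      intro heq
      apply hne
      rw [← ENNReal.toReal_eq_toReal_iff' (measure_ne_top _ _) (measure_ne_top _ _), heq]
      unfold pcell
      rw [Measure.prod_prod, volume_cell _ (by positivity) i hi, ENNReal.toReal_mul,
        ENNReal.toReal_ofReal (by positivity)])
  have h1 : measureDim θ ≤ dimH A := iInf_le_of_le A (iInf_le_of_le hAm (iInf_le _ hApos))
  have h2 := dim_lower ρ d hd
  have h3 : 1 + ENNReal.ofReal d ≤ dimH A := by
    refine le_trans ?_ h1
    rw [hdim]
    gcongr
  exact absurd hAdim (not_lt.2 h3)
end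

section
/- Let θ and ν be Borel probability measures on [0,1]² such that θ = τ × α, where α = ∑_{i=1}^r p_i δ_{z_i} is a convex combination of finitely many atomic measures. Then for P₂(ν*θ)-almost every z, the conditional measure (ν*θ)_z of ν*θ with respect to the projection P₂ is the finite convex combination (ν*θ)_z = ∑_{i=1}^r q_i(z) · ( ν_{z−z_i} * (τ × δ_{z_i}) ), where q_i(z) = p_i · d(P₂(ν*(τ×δ_{z_i})))/d(P₂(ν*θ))(z) and ν_{z−z_i} is the conditional measure of ν with respect to P₂ at z−z_i. -/
open MeasureTheory Filter Set Topology
open scoped ENNReal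

open ProbabilityTheory

lemma lintegral_conv_prod_dirac_aux (ν : Measure (ℝ × ℝ)) (τ : Measure ℝ)
    [IsProbabilityMeasure τ] (c : ℝ) (F : ℝ × ℝ → ℝ≥0∞) (hF : Measurable F) :
    ∫⁻ w, F w ∂(ν.conv (τ.prod (Measure.dirac c))) = ∫⁻ w, ∫⁻ t, F (w.1 + t, w.2 + c) ∂τ ∂ν := by
  rw [Measure.lintegral_conv hF]
  refine lintegral_congr fun w ↦ ?_
  rw [lintegral_prod _ (by fun_prop)]
  refine lintegral_congr fun t ↦ ?_
  rw [lintegral_dirac' _ (by fun_prop)]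
  rfl

lemma isFiniteKernel_finsetSum_aux {ι α β : Type*} [MeasurableSpace α] [MeasurableSpace β]
    (κ : ι → Kernel α β) [∀ i, IsFiniteKernel (κ i)] (I : Finset ι) :
    IsFiniteKernel (∑ i ∈ I, κ i) := by
  classical
  induction I using Finset.induction with
  | empty => rw [Finset.sum_empty]; infer_instance
  | insert i I hi h => rw [Finset.sum_insert hi]; infer_instance

lemma fiberMeasure_eq_aux (ν : Measure (ℝ × ℝ)) [IsFiniteMeasure ν] (y : ℝ) :
    fiberMeasure ν y = (ν.map Prod.swap).condKernel y := by
  have h : IsFiniteMeasure (ν.map Prod.swap) := inferInstance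
  simp only [fiberMeasure, h, dite_true]

/-- fiberwise convolution kernel -/
noncomputable def convKernelAux (ν : Measure (ℝ × ℝ)) [IsFiniteMeasure ν] (τ : Measure ℝ)
    (c : ℝ) : Kernel ℝ ℝ :=
  (((ν.map Prod.swap).condKernel.comap (fun y : ℝ ↦ y - c) (by fun_prop)) ×ₖ
    (Kernel.const ℝ τ)).map (fun p : ℝ × ℝ ↦ p.1 + p.2)

lemma convKernelAux_apply (ν : Measure (ℝ × ℝ)) [IsFiniteMeasure ν] (τ : Measure ℝ)
    [IsProbabilityMeasure τ] (c y : ℝ) :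
    convKernelAux ν τ c y = (fiberMeasure ν (y - c)).conv τ := by
  rw [convKernelAux, Kernel.map_apply _ (by fun_prop), Kernel.prod_apply, Kernel.comap_apply,
    Kernel.const_apply, fiberMeasure_eq_aux]
  rfl

instance (ν : Measure (ℝ × ℝ)) [IsFiniteMeasure ν] (τ : Measure ℝ) [IsProbabilityMeasure τ]
    (c : ℝ) : IsMarkovKernel (convKernelAux ν τ c) := by
  unfold convKernelAux
  have : IsMarkovKernel ((ν.map Prod.swap).condKernel.comap (fun y : ℝ ↦ y - c) (by fun_prop)) :=
    inferInstance
  exact Kernel.IsMarkovKernel.map _ (by fun_prop)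

/-- Disintegration of `ν * (τ × δ_c)`. -/
lemma disint_single_aux (ν : Measure (ℝ × ℝ)) [IsProbabilityMeasure ν] (τ : Measure ℝ)
    [IsProbabilityMeasure τ] (c : ℝ) (F : ℝ × ℝ → ℝ≥0∞) (hF : Measurable F) :
    ∫⁻ y, ∫⁻ x, F (x, y) ∂(convKernelAux ν τ c y)
        ∂((ν.conv (τ.prod (Measure.dirac c))).map Prod.snd)
      = ∫⁻ w, F w ∂(ν.conv (τ.prod (Measure.dirac c))) := by
  have hG : Measurable fun y ↦ ∫⁻ x, F (x, y) ∂(convKernelAux ν τ c y) :=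
    Measurable.lintegral_kernel_prod_right' (f := fun p : ℝ × ℝ ↦ F (p.2, p.1)) (by fun_prop)
  rw [lintegral_map hG measurable_snd,
    lintegral_conv_prod_dirac_aux _ _ _
      (fun a : ℝ × ℝ ↦ ∫⁻ x, F (x, a.2) ∂(convKernelAux ν τ c a.2)) (hG.comp measurable_snd),
    lintegral_conv_prod_dirac_aux _ _ _ _ hF]
  simp only [lintegral_const, measure_univ, mul_one]
  have e : ν = ((ν.map Prod.swap).fst ⊗ₘ (ν.map Prod.swap).condKernel).map Prod.swap := by
    rw [Measure.disintegrate, Measure.map_map measurable_swap measurable_swap]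
    simp
  have hfst : (ν.map Prod.swap).fst = ν.map Prod.snd := by
    rw [Measure.fst, Measure.map_map measurable_fst measurable_swap]
    rfl
  have hH : Measurable fun w : ℝ × ℝ ↦ ∫⁻ t, F (w.1 + t, w.2 + c) ∂τ :=
    Measurable.lintegral_prod_right' (f := fun p : (ℝ × ℝ) × ℝ ↦ F (p.1.1 + p.2, p.1.2 + c))
      (by fun_prop)
  have hS : Measurable fun a : ℝ × ℝ ↦ ∫⁻ t, F (a.swap.1 + t, a.swap.2 + c) ∂τ :=
    hH.comp measurable_swap
  conv_rhs => rw [e, lintegral_map hH measurable_swap,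
    Measure.lintegral_compProd hS, hfst,
    lintegral_map (Measurable.lintegral_kernel_prod_right' hS)
      measurable_snd]
  refine lintegral_congr fun w ↦ ?_
  rw [convKernelAux_apply, Measure.lintegral_conv (by fun_prop), fiberMeasure_eq_aux]
  simp

/-- Claim 3.3 of the paper.  Let `θ = τ × α` and `ν` be probability
measures on `[0,1]²` (convolutions taken in `ℝ²`), where `α = ∑ᵢ pᵢ δ_{zᵢ}` is a finite
convex combination of atoms.  Then for `P₂(ν∗θ)`-a.e. `z`, the conditional measure of
`ν∗θ` on the fiber over `z` is the convex combination
`(ν∗θ)_z = ∑ᵢ qᵢ(z) • (ν_{z−zᵢ} ∗ (τ × δ_{zᵢ}))` (read on the fiber, i.e. convolved with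
`τ` in the first coordinate), where
`qᵢ(z) = pᵢ · d(P₂(ν∗(τ×δ_{zᵢ})))/d(P₂(ν∗θ))(z)`. -/
theorem conditional_measures_of_convolution
    (r : ℕ) (p : Fin r → ℝ≥0∞) (hp : ∑ i, p i = 1)
    (z : Fin r → ℝ) (hz : ∀ i, z i ∈ Set.Icc (0:ℝ) 1)
    (α : Measure ℝ) (hα : α = ∑ i, p i • Measure.dirac (z i))
    (τ : Measure ℝ) [IsProbabilityMeasure τ] (hτsupp : τ (Set.Icc (0:ℝ) 1)ᶜ = 0)
    (θ : Measure (ℝ × ℝ)) (hθ : θ = τ.prod α)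
    (ν : Measure (ℝ × ℝ)) [IsProbabilityMeasure ν]
    (hνsupp : ν ((Set.Icc (0:ℝ) 1 ×ˢ Set.Icc (0:ℝ) 1)ᶜ) = 0) :
    ∀ᵐ y ∂((ν.conv θ).map Prod.snd),
      fiberMeasure (ν.conv θ) y =
        ∑ i, (p i * ((ν.conv (τ.prod (Measure.dirac (z i)))).map Prod.snd).rnDeriv
            ((ν.conv θ).map Prod.snd) y) •
          ((fiberMeasure ν (y - z i)).conv τ) := by
  classical
  have hp1 : ∀ i, p i ≤ 1 := fun i ↦ hp ▸ Finset.single_le_sum (fun _ _ ↦ zero_le) (Finset.mem_univ i)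
  have hptop : ∀ i, p i ≠ ∞ := fun i ↦ ((hp1 i).trans_lt ENNReal.one_lt_top).ne
  have hsum : ν.conv θ = ∑ i, p i • ν.conv (τ.prod (Measure.dirac (z i))) := by
    have : IsFiniteMeasure α := by
      have : ∀ i, IsFiniteMeasure (p i • Measure.dirac (z i)) :=
        fun i ↦ Measure.smul_finite _ (hptop i)
      rw [hα]; infer_instance
    refine Measure.ext_of_lintegral _ fun F hF ↦ ?_
    have hm : ∀ i, Measurable fun w : ℝ × ℝ ↦ ∫⁻ t, F (w.1 + t, w.2 + z i) ∂τ := fun i ↦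
      Measurable.lintegral_prod_right'
        (f := fun p : (ℝ × ℝ) × ℝ ↦ F (p.1.1 + p.2, p.1.2 + z i)) (by fun_prop)
    rw [hθ, Measure.lintegral_conv hF, lintegral_finsetSum_measure]
    simp_rw [lintegral_smul_measure, lintegral_conv_prod_dirac_aux _ _ _ _ hF, smul_eq_mul]
    simp_rw [← lintegral_const_mul _ (hm _)]
    rw [← lintegral_finsetSum _ (fun i _ ↦ (hm i).const_mul _)]
    refine lintegral_congr fun w ↦ ?_
    rw [lintegral_prod _ (by fun_prop)]
    simp_rw [hα, lintegral_finsetSum_measure, lintegral_smul_measure, smul_eq_mul]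
    rw [lintegral_finsetSum' _ (fun i _ ↦ by
      simp only [lintegral_dirac]
      fun_prop)]
    refine Finset.sum_congr rfl fun i _ ↦ ?_
    simp only [lintegral_dirac]
    rw [lintegral_const_mul _ (by fun_prop)]
    rfl
  have hfin : IsFiniteMeasure (ν.conv θ) := by
    have : ∀ i, IsFiniteMeasure (p i • ν.conv (τ.prod (Measure.dirac (z i)))) :=
      fun i ↦ Measure.smul_finite _ (hptop i)
    rw [hsum]
    infer_instance
  set μ := (ν.conv θ).map Prod.snd with hμ
  set m : Fin r → Measure ℝ := fun i ↦ (ν.conv (τ.prod (Measure.dirac (z i)))).map Prod.snd with hm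
  have hle : ∀ i, p i • m i ≤ μ := by
    intro i
    refine Measure.le_iff.2 fun s hs ↦ ?_
    rw [hμ, hsum, hm, Measure.map_apply measurable_snd hs, Measure.smul_apply,
      Measure.map_apply measurable_snd hs, Measure.finsetSum_apply]
    exact Finset.single_le_sum (f := fun i ↦ (p i • ν.conv (τ.prod (Measure.dirac (z i))))
      (Prod.snd ⁻¹' s)) (fun _ _ ↦ zero_le) (Finset.mem_univ i)
  have : ∀ i, IsFiniteMeasure (p i • m i) := fun i ↦ Measure.smul_finite _ (hptop i)
  set q : Fin r → ℝ → ℝ≥0∞ := fun i y ↦ min ((p i • m i).rnDeriv μ y) 1 with hq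
  have hqm : ∀ i, Measurable (q i) := fun i ↦ (Measure.measurable_rnDeriv _ _).min measurable_const
  have hqae : ∀ i, q i =ᵐ[μ] (p i • m i).rnDeriv μ := by
    intro i
    filter_upwards [Measure.rnDeriv_le_one_of_le (hle i)] with y hy
    exact min_eq_left hy
  have hqd : ∀ i, μ.withDensity (q i) = p i • m i := fun i ↦ by
    rw [withDensity_congr_ae (hqae i),
      Measure.withDensity_rnDeriv_eq _ _ (Measure.absolutelyContinuous_of_le (hle i))]
  have hqu : ∀ i, Measurable (Function.uncurry fun (y : ℝ) (_ : ℝ) ↦ q i y) :=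
    fun i ↦ (hqm i).comp measurable_fst
  let K : Fin r → Kernel ℝ ℝ := fun i ↦ (convKernelAux ν τ (z i)).withDensity (fun y _ ↦ q i y)
  have : ∀ i, IsFiniteKernel (K i) := fun i ↦
    Kernel.isFiniteKernel_withDensity_of_bounded _ ENNReal.one_ne_top (fun y _ ↦ min_le_right _ _)
  have := isFiniteKernel_finsetSum_aux K Finset.univ
  have hfst : ((ν.conv θ).map Prod.swap).fst = μ := by
    rw [Measure.fst, Measure.map_map measurable_fst measurable_swap]
    rfl
  have key : (ν.conv θ).map Prod.swap = ((ν.conv θ).map Prod.swap).fst ⊗ₘ (∑ i, K i) := by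
    rw [hfst]
    refine Measure.ext_of_lintegral _ fun F hF ↦ ?_
    rw [Measure.lintegral_compProd hF, lintegral_map hF measurable_swap, hsum,
      lintegral_finsetSum_measure]
    have hG : ∀ i, Measurable fun y ↦ ∫⁻ x, F (y, x) ∂(convKernelAux ν τ (z i) y) := fun i ↦
      Measurable.lintegral_kernel_prod_right' hF
    have h1 : ∀ y, ∫⁻ x, F (y, x) ∂((∑ i, K i) y)
        = ∑ i, q i y * ∫⁻ x, F (y, x) ∂(convKernelAux ν τ (z i) y) := by
      intro y
      rw [sum_apply, lintegral_finsetSum_measure]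
      refine Finset.sum_congr rfl fun i _ ↦ ?_
      rw [Kernel.lintegral_withDensity _ (hqu i) _ (by fun_prop),
        lintegral_const_mul _ (by fun_prop)]
    simp_rw [h1]
    have hqG : ∀ i, Measurable fun y ↦ q i y * ∫⁻ x, F (y, x) ∂(convKernelAux ν τ (z i) y) :=
      fun i ↦ (hqm i).mul (hG i)
    rw [lintegral_finsetSum _ (fun i _ ↦ hqG i)]
    refine Finset.sum_congr rfl fun i _ ↦ ?_
    have := lintegral_withDensity_eq_lintegral_mul μ (hqm i) (hG i)
    simp only [Pi.mul_apply] at this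
    rw [← this, hqd, lintegral_smul_measure, lintegral_smul_measure]
    congr 1
    exact (disint_single_aux ν τ (z i) (fun w ↦ F w.swap) (by fun_prop)).symm
  have huniq := eq_condKernel_of_measure_eq_compProd (∑ i, K i) key
  rw [hfst] at huniq
  have hrn : ∀ᵐ y ∂μ, ∀ i, q i y = p i * (m i).rnDeriv μ y := by
    rw [ae_all_iff]
    intro i
    filter_upwards [hqae i, Measure.rnDeriv_smul_left_of_ne_top (m i) μ (hptop i)] with y h1 h2
    rw [h1, h2]
    rfl
  filter_upwards [huniq, hrn] with y h1 h2
  rw [fiberMeasure_eq_aux, ← h1, sum_apply]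
  refine Finset.sum_congr rfl fun i _ ↦ ?_
  rw [Kernel.withDensity_apply _ (hqu i), withDensity_const, convKernelAux_apply, h2 i]
end
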